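/- arXiv:2504.11916 — 2 statements merged into one kernel-verified Lean document; each statement's English description precedes it below -/
import Mathlib

section
/- Let c₁, c₂ > 0 and ε ∈ (0, 1/2). There exist δ > 0 and C > 0 such that for every integer q ≥ 3 with q ≢ 2 (mod 4) and all θ₁, θ₂ ∈ (0, 1/2 − ε], with M = q^{θ₁}, R = q^{θ₂} and the mollifier M(χ) as in the context, one has | (2/φ*(q)) ∑_{χ even primitive mod q} L(1/2, χ) M(χ) − (c₁ + c₂) | ≤ C q^{−δ}. -/
/-- The value `L(s,χ)` of the analytically continued Dirichlet `L`-function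
(junk value `0` when `q = 0`). -/
noncomputable def Lval (q : ℕ) (χ : DirichletCharacter ℂ q) (s : ℂ) : ℂ :=
  if h : q = 0 then 0 else
    letI : NeZero q := ⟨h⟩
    DirichletCharacter.LFunction χ s

/-- `φ*(q)`: the number of primitive Dirichlet characters modulo `q`. -/
noncomputable def phistar (q : ℕ) : ℕ :=
  Nat.card {χ : DirichletCharacter ℂ q // χ.IsPrimitive}
/-- The Gauss sum `τ_χ = ∑_{n mod q} χ(n) e^{2πi n/q}`. -/
noncomputable def gaussSum' (q : ℕ) (χ : DirichletCharacter ℂ q) : ℂ :=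
  ∑ n ∈ Finset.range q, χ (n : ZMod q) * Complex.exp (2 * Real.pi * Complex.I * n / q)

/-- The mollifier coefficients `a_y(m) = μ(m) log(y/m)/log y`. -/
noncomputable def acoef (y : ℝ) (m : ℕ) : ℝ :=
  ((ArithmeticFunction.moebius m : ℤ) : ℝ) * Real.log (y / m) / Real.log y

/-- The two-piece mollifier
`M(χ) = c₁ ∑_{m ≤ q^θ₁} a(m) χ(m) m^{-1/2}
      + c₂ (conj τ_χ) q^{-1/2} ∑_{m ≤ q^θ₂} a(m) conj(χ(m)) m^{-1/2}`. -/
noncomputable def mollifier (q : ℕ) (θ₁ θ₂ c₁ c₂ : ℝ) (χ : DirichletCharacter ℂ q) : ℂ :=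
  (c₁ : ℂ) * ∑ m ∈ Finset.Icc 1 ⌊(q : ℝ) ^ θ₁⌋₊,
      (acoef ((q : ℝ) ^ θ₁) m : ℂ) * χ (m : ZMod q) / (Real.sqrt m : ℂ)
  + (c₂ : ℂ) * (starRingEnd ℂ) (gaussSum' q χ) / (Real.sqrt q : ℂ) *
      ∑ m ∈ Finset.Icc 1 ⌊(q : ℝ) ^ θ₂⌋₊,
        (acoef ((q : ℝ) ^ θ₂) m : ℂ) * (starRingEnd ℂ) (χ (m : ZMod q)) / (Real.sqrt m : ℂ)

namespace MollifiedMoment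

/-- The finitely many Dirichlet characters modulo `n`, as a `Fintype`. -/
noncomputable local instance dirichletFintype (n : ℕ) [NeZero n] :
    Fintype (DirichletCharacter ℂ n) := .ofFinite _

section PrimitiveCharacters

open Finset DirichletCharacter
open scoped ArithmeticFunction.Moebius Classical

theorem sum_conductor_dvd {q w : ℕ} [NeZero q] (hw : w ∣ q) {k : ℤ} (hk : IsCoprime k (q : ℤ)) :
    ∑ χ : DirichletCharacter ℂ q with χ.conductor ∣ w, χ (k : ZMod q) =
      if (k : ZMod w) = 1 then (w.totient : ℂ) else 0 := by
  have : NeZero w := ⟨fun h => NeZero.ne q (Nat.eq_zero_of_zero_dvd (h ▸ hw))⟩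
  rw [← sum_characters_eq ℂ (k : ZMod w)]
  symm
  refine sum_nbij (changeLevel hw) ?_ ?_ ?_ ?_
  · intro χ _
    simp only [mem_filter, mem_univ, true_and]
    exact (mem_conductorSet_iff_conductor_dvd _ hw).1 (changeLevel_factorsThrough χ hw)
  · exact (changeLevel_injective hw).injOn
  · intro χ hχ
    simp only [coe_filter, mem_univ, true_and, Set.mem_ofPred_eq] at hχ
    obtain ⟨_, χ₀, h⟩ := (mem_conductorSet_iff_conductor_dvd χ hw).2 hχ
    exact ⟨χ₀, by simp, h.symm⟩
  · intro χ _
    exact (changeLevel_eq_cast_of_dvd' χ hw hk).symm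

theorem sum_moebius_div {q c : ℕ} (hq : q ≠ 0) (hc : c ∣ q) :
    ∑ w ∈ q.divisors with c ∣ w, (μ (q / w) : ℤ) = if c = q then 1 else 0 := by
  obtain ⟨e, rfl⟩ := hc
  have hc0 : c ≠ 0 := left_ne_zero_of_mul hq
  have he0 : e ≠ 0 := right_ne_zero_of_mul hq
  have h1 : ∑ w ∈ (c * e).divisors with c ∣ w, (μ (c * e / w) : ℤ) =
      ∑ d ∈ e.divisors, μ (e / d) := by
    symm
    refine sum_nbij (c * ·) ?_ ?_ ?_ ?_
    · intro d hd
      simp only [Nat.mem_divisors, mem_filter] at hd ⊢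
      exact ⟨⟨mul_dvd_mul_left c hd.1, hq⟩, dvd_mul_right _ _⟩
    · intro a _ b _ h
      exact Nat.eq_of_mul_eq_mul_left (Nat.pos_of_ne_zero hc0) h
    · intro w hw
      simp only [coe_filter, Nat.mem_divisors, Set.mem_ofPred_eq] at hw
      obtain ⟨⟨h1, _⟩, d, rfl⟩ := hw
      exact ⟨d, by simpa [he0] using Nat.dvd_of_mul_dvd_mul_left (Nat.pos_of_ne_zero hc0) h1, rfl⟩
    · intro d _
      rw [Nat.mul_div_mul_left _ _ (Nat.pos_of_ne_zero hc0)]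
  rw [h1, Nat.sum_div_divisors e (fun d => (μ d : ℤ)),
    ← ArithmeticFunction.coe_mul_zeta_apply, ArithmeticFunction.moebius_mul_coe_zeta,
    ArithmeticFunction.one_apply]
  congr 1
  simp [hc0]

theorem sum_primitive {q : ℕ} [NeZero q] {k : ℤ} (hk : IsCoprime k (q : ℤ)) :
    ∑ χ : DirichletCharacter ℂ q with χ.IsPrimitive, χ (k : ZMod q) =
      ∑ w ∈ q.divisors, (μ (q / w) : ℂ) * if (k : ZMod w) = 1 then (w.totient : ℂ) else 0 := by
  have h : ∀ w ∈ q.divisors, ((μ (q / w) : ℂ) * if (k : ZMod w) = 1 then (w.totient : ℂ) else 0) =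
      ∑ χ : DirichletCharacter ℂ q, if χ.conductor ∣ w then (μ (q / w) : ℂ) * χ k else 0 := by
    intro w hw
    rw [← sum_conductor_dvd (Nat.dvd_of_mem_divisors hw) hk, mul_sum, sum_filter]
  rw [sum_congr rfl h, sum_comm, sum_filter]
  refine sum_congr rfl fun χ _ => ?_
  rw [← sum_filter, ← sum_mul]
  have := congrArg (Int.cast : ℤ → ℂ) (sum_moebius_div (NeZero.ne q) χ.conductor_dvd_level)
  push_cast at this
  rw [this, isPrimitive_def]
  split_ifs <;> simp

theorem norm_sum_primitive_le {q : ℕ} [NeZero q] {k : ℤ} (hk : IsCoprime k (q : ℤ)) :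
    ‖∑ χ : DirichletCharacter ℂ q with χ.IsPrimitive, χ (k : ZMod q)‖ ≤
      ∑ w ∈ q.divisors, if (w : ℤ) ∣ k - 1 then (w : ℝ) else 0 := by
  rw [sum_primitive hk]
  refine (norm_sum_le _ _).trans (sum_le_sum fun w _ => ?_)
  rw [norm_mul]
  have h1 : ‖(μ (q / w) : ℂ)‖ ≤ 1 := by
    rw [Complex.norm_intCast]
    exact_mod_cast ArithmeticFunction.abs_moebius_le_one
  have h2 : (k : ZMod w) = 1 ↔ (w : ℤ) ∣ k - 1 := by
    rw [← ZMod.intCast_zmod_eq_zero_iff_dvd, Int.cast_sub, Int.cast_one, sub_eq_zero]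
  simp only [h2]
  split_ifs
  · rw [Complex.norm_natCast]
    calc _ ≤ 1 * (w.totient : ℝ) := by gcongr
      _ ≤ w := by rw [one_mul]; exact_mod_cast Nat.totient_le w
  · simp

theorem card_primitive_eq {q : ℕ} [NeZero q] :
    ((#{χ : DirichletCharacter ℂ q | χ.IsPrimitive} : ℕ) : ℤ) =
      ∑ w ∈ q.divisors, μ (q / w) * (w.totient : ℤ) := by
  have := sum_primitive (q := q) (k := 1) isCoprime_one_left
  simp only [Int.cast_one, map_one, sum_const, if_true, nsmul_eq_mul, mul_one] at this
  exact_mod_cast this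

/-- Euler's totient as an integer-valued arithmetic function. -/
def totientFun : ArithmeticFunction ℤ := ⟨fun n => (n.totient : ℤ), by simp⟩

@[simp] theorem totientFun_apply (n : ℕ) : totientFun n = n.totient := rfl

/-- The convolution `μ * φ`, counting primitive characters. -/
def primCount : ArithmeticFunction ℤ := μ * totientFun

theorem primCount_isMultiplicative : primCount.IsMultiplicative := by
  refine ArithmeticFunction.isMultiplicative_moebius.mul ?_
  rw [ArithmeticFunction.IsMultiplicative.iff_ne_zero]
  refine ⟨by simp, fun {m n} _ _ h => ?_⟩
  simp [Nat.totient_mul h]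

theorem primCount_prime_pow {p k : ℕ} (hp : p.Prime) :
    primCount (p ^ (k + 1)) = ((p ^ (k + 1)).totient : ℤ) - (p ^ k).totient := by
  rw [primCount, ArithmeticFunction.mul_apply, Nat.sum_divisorsAntidiagonal
    (f := fun a b => μ a * totientFun b),
    Nat.sum_divisors_prime_pow hp, sum_range_succ', sum_range_succ']
  have h : ∀ i ∈ range k, μ (p ^ (i + 1 + 1)) *
      totientFun
        (p ^ (k + 1) / p ^ (i + 1 + 1)) = 0 := by
    intro i _
    rw [ArithmeticFunction.moebius_apply_prime_pow hp (by omega)]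
    simp
  rw [sum_eq_zero h]
  have h2 : p ^ (k + 1) / p = p ^ k := by
    rw [pow_succ, Nat.mul_div_cancel _ hp.pos]
  simp [ArithmeticFunction.moebius_apply_prime hp, h2]
  ring

theorem primCount_prime_pow_ge {p k : ℕ} (hp : p.Prime) (h : ¬ (p ^ (k + 1) = 2)) :
    ((p ^ (k + 1) : ℕ) : ℤ) ≤ primCount (p ^ (k + 1)) * ((k + 2 : ℕ) : ℤ) ^ 2 := by
  rw [primCount_prime_pow hp]
  rcases k with _ | k
  · have h3 : 3 ≤ p := by
      have := hp.two_le
      simp at h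
      omega
    simp [Nat.totient_prime hp]
    rw [Nat.cast_sub hp.one_le]
    push_cast
    have : (3 : ℤ) ≤ p := by exact_mod_cast h3
    linarith
  · rw [Nat.totient_prime_pow_succ hp, Nat.totient_prime_pow_succ hp]
    push_cast
    rw [Nat.cast_sub hp.one_le]
    have h2 : (2 : ℤ) ≤ p := by exact_mod_cast hp.two_le
    have hpk : (0 : ℤ) < (p : ℤ) ^ k := by positivity
    have h4 : (p : ℤ) ^ 2 ≤ 4 * ((p : ℤ) - 1) ^ 2 := by nlinarith
    have h5 : (4 : ℤ) ≤ ((k : ℤ) + 1 + 2) ^ 2 := by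
      have : (0 : ℤ) ≤ k := by positivity
      nlinarith
    have e : (p : ℤ) ^ (k + 1) * ((p : ℤ) - 1) - (p : ℤ) ^ k * ((p : ℤ) - 1) =
      (p : ℤ) ^ k * ((p : ℤ) - 1) ^ 2 := by ring
    push_cast
    rw [e]
    calc (p : ℤ) ^ (k + 1 + 1) = p ^ k * p ^ 2 := by ring
      _ ≤ p ^ k * (4 * ((p : ℤ) - 1) ^ 2) := by gcongr
      _ = p ^ k * ((p : ℤ) - 1) ^ 2 * 4 := by ring
      _ ≤ _ := by gcongr

theorem le_primCount_mul_card_divisors_sq (q : ℕ) :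
    0 < q → q % 4 ≠ 2 → (q : ℤ) ≤ primCount q * (#q.divisors : ℤ) ^ 2 := by
  induction q using Nat.recOnPosPrimePosCoprime with
  | zero => intro h; exact absurd h (lt_irrefl _)
  | one => intro _ _; simp [primCount_isMultiplicative.map_one]
  | prime_pow p n hp hn =>
    intro _ h
    obtain ⟨k, rfl⟩ : ∃ k, n = k + 1 := ⟨n - 1, by omega⟩
    rw [Nat.divisors_prime_pow hp, card_map, card_range]
    exact primCount_prime_pow_ge hp fun h2 => h (by rw [h2])
  | coprime a b ha hb hab iha ihb =>
    intro _ h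
    have key : ∀ a b : ℕ, a.Coprime b → (a * b) % 4 ≠ 2 → a % 4 ≠ 2 := by
      intro a b hab h ha
      have hb : b % 2 = 1 := by
        by_contra hb
        have h2 : 2 ∣ Nat.gcd a b := Nat.dvd_gcd (by omega) (by omega)
        rw [hab] at h2
        omega
      apply h
      rw [Nat.mul_mod, ha]
      have : b % 4 = 1 ∨ b % 4 = 3 := by omega
      rcases this with h | h <;> simp [h]
    have h1 := iha (by omega) (key a b hab h)
    have h2 := ihb (by omega) (key b a hab.symm (by rwa [mul_comm]))
    rw [primCount_isMultiplicative.map_mul_of_coprime hab, hab.card_divisors_mul]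
    push_cast
    calc (a : ℤ) * b ≤ (primCount a * (#a.divisors : ℤ) ^ 2) *
          (primCount b * (#b.divisors : ℤ) ^ 2) :=
        mul_le_mul h1 h2 (by positivity) (le_trans (by positivity) h1)
      _ = _ := by ring

theorem card_primitive_eq_phistar {q : ℕ} [NeZero q] :
    #{χ : DirichletCharacter ℂ q | χ.IsPrimitive} =
      Nat.card {χ : DirichletCharacter ℂ q // χ.IsPrimitive} := by
  rw [Nat.card_eq_fintype_card, Fintype.card_subtype]

theorem le_card_primitive {q : ℕ} [NeZero q] (h : q % 4 ≠ 2) :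
    (q : ℝ) ≤ #{χ : DirichletCharacter ℂ q | χ.IsPrimitive} * (#q.divisors : ℝ) ^ 2 := by
  have h1 := le_primCount_mul_card_divisors_sq q (Nat.pos_of_ne_zero (NeZero.ne q)) h
  have h2 : primCount q = (#{χ : DirichletCharacter ℂ q | χ.IsPrimitive} : ℤ) := by
    rw [card_primitive_eq, primCount, ArithmeticFunction.mul_apply,
      Nat.sum_divisorsAntidiagonal' (f := fun a b => μ a *
        totientFun b)]
    rfl
  rw [h2] at h1
  exact_mod_cast h1

end PrimitiveCharacters

section DivisorBound

open Finset

theorem card_divisors_le_pow_mul_rpow {η : ℝ} (hη : 0 < η) (n : ℕ) : 0 < n →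
    (#n.divisors : ℝ) ≤ (1 + 1 / (η * Real.log 2)) ^
      #(n.primeFactors.filter fun p : ℕ => (p : ℝ) < 2 ^ (1 / η)) * (n : ℝ) ^ η := by
  have hl : 0 < η * Real.log 2 := mul_pos hη (Real.log_pos one_lt_two)
  have hA : 1 ≤ 1 + 1 / (η * Real.log 2) := by
    have : 0 < 1 / (η * Real.log 2) := by positivity
    linarith
  induction n using Nat.recOnPosPrimePosCoprime with
  | zero => intro h; exact absurd h (lt_irrefl _)
  | one => intro _; simp
  | prime_pow p k hp hk =>
    intro _
    rw [Nat.divisors_prime_pow hp, card_map, card_range, Nat.primeFactors_prime_pow hk.ne' hp,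
      filter_singleton]
    have hpos : (0 : ℝ) < p := by exact_mod_cast hp.pos
    have h2 : (2 : ℝ) ≤ p := by exact_mod_cast hp.two_le
    have e : ((p ^ k : ℕ) : ℝ) ^ η = ((p : ℝ) ^ η) ^ k := by
      rw [Nat.cast_pow, ← Real.rpow_natCast, ← Real.rpow_natCast, ← Real.rpow_mul hpos.le,
        ← Real.rpow_mul hpos.le, mul_comm]
    rw [e]
    split_ifs with h
    · rw [card_singleton, pow_one]
      have h3 : 1 + k * (η * Real.log 2) ≤ ((p : ℝ) ^ η) ^ k := by
        calc 1 + k * (η * Real.log 2) ≤ Real.exp (k * (η * Real.log 2)) := by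
              linarith [Real.add_one_le_exp (k * (η * Real.log 2))]
          _ = ((2 : ℝ) ^ η) ^ k := by
              rw [Real.exp_nat_mul, mul_comm η, ← Real.rpow_def_of_pos two_pos]
          _ ≤ _ := by gcongr
      calc ((k + 1 : ℕ) : ℝ) ≤ (1 + 1 / (η * Real.log 2)) * (1 + k * (η * Real.log 2)) := by
            have : (1 + 1 / (η * Real.log 2)) * (1 + k * (η * Real.log 2)) =
              1 + k + (k * (η * Real.log 2) + 1 / (η * Real.log 2)) := by
              field_simp
              ring
            rw [this]
            push_cast
            have : 0 ≤ k * (η * Real.log 2) + 1 / (η * Real.log 2) := by positivity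
            linarith
        _ ≤ _ := by gcongr
    · rw [card_empty, pow_zero, one_mul]
      have h3 : (2 : ℝ) ≤ (p : ℝ) ^ η := by
        calc (2 : ℝ) = ((2 : ℝ) ^ (1 / η)) ^ η := by
              rw [← Real.rpow_mul two_pos.le, one_div_mul_cancel hη.ne', Real.rpow_one]
          _ ≤ _ := by
            push Not at h
            gcongr
      calc ((k + 1 : ℕ) : ℝ) ≤ (2 : ℝ) ^ k := by exact_mod_cast Nat.lt_two_pow_self
        _ ≤ _ := by gcongr
  | coprime a b ha hb hab iha ihb =>
    intro _
    have h1 := iha (by omega)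
    have h2 := ihb (by omega)
    rw [hab.card_divisors_mul, hab.primeFactors_mul, filter_union, card_union_of_disjoint
      (disjoint_filter_filter hab.disjoint_primeFactors), pow_add, Nat.cast_mul, Nat.cast_mul,
      Real.mul_rpow (by positivity) (by positivity)]
    calc (#a.divisors : ℝ) * #b.divisors ≤ _ :=
          mul_le_mul h1 h2 (by positivity) (by positivity)
      _ = _ := by ring

/-- The divisor bound `d(n) ≪ n ^ η`. -/
theorem exists_card_divisors_le {η : ℝ} (hη : 0 < η) :
    ∃ C : ℝ, 1 ≤ C ∧ ∀ n : ℕ, 0 < n → (#n.divisors : ℝ) ≤ C * (n : ℝ) ^ η := by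
  have hA : 1 ≤ 1 + 1 / (η * Real.log 2) := by
    have : 0 < 1 / (η * Real.log 2) := by
      have := Real.log_pos one_lt_two
      positivity
    linarith
  refine ⟨(1 + 1 / (η * Real.log 2)) ^ ⌈(2 : ℝ) ^ (1 / η)⌉₊, one_le_pow₀ hA, fun n hn => ?_⟩
  refine (card_divisors_le_pow_mul_rpow hη n hn).trans ?_
  gcongr
  calc _ ≤ #(range ⌈(2 : ℝ) ^ (1 / η)⌉₊) := by
        refine card_le_card fun p hp => ?_
        simp only [mem_filter] at hp
        exact mem_range.2 (Nat.lt_ceil.2 hp.2)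
    _ = _ := card_range _

end DivisorBound

section PolyaVinogradov

open Finset DirichletCharacter ZMod
open scoped Real

theorem sum_range_natCast {q : ℕ} [NeZero q] {M : Type*} [AddCommMonoid M] (f : ZMod q → M) :
    ∑ n ∈ range q, f (n : ZMod q) = ∑ a, f a := by
  refine sum_nbij' (fun n => (n : ZMod q)) ZMod.val ?_ ?_ ?_ ?_ ?_
  · simp
  · intro a _; simpa using ZMod.val_lt a
  · intro n hn; exact ZMod.val_cast_of_lt (by simpa using hn)
  · intro a _; simp
  · simp

theorem isPrimitive_inv {q : ℕ} {χ : DirichletCharacter ℂ q} (hχ : χ.IsPrimitive) :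
    χ⁻¹.IsPrimitive := by
  rw [isPrimitive_def, conductor_inv]
  exact hχ

theorem norm_gaussSum_sq {q : ℕ} [NeZero q] {χ : DirichletCharacter ℂ q} (hχ : χ.IsPrimitive) :
    ‖gaussSum χ stdAddChar‖ ^ 2 = q := by
  have h1 : ∀ j, dft (dft χ) j = (q : ℂ) * χ (-j) := fun j => by simp [dft_dft]
  have h2 : (dft χ : ZMod q → ℂ) = fun k => (χ⁻¹ (-1) * gaussSum χ stdAddChar) * χ⁻¹ k := by
    ext k
    rw [hχ.fourierTransform_eq_inv_mul_gaussSum, neg_eq_neg_one_mul, map_mul]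
    ring
  have h3 := h1 (-1)
  rw [h2, dft_const_mul] at h3
  simp only [(isPrimitive_inv hχ).fourierTransform_eq_inv_mul_gaussSum, neg_neg, inv_inv,
    map_one, mul_one, one_mul] at h3
  have h4 : gaussSum χ⁻¹ stdAddChar⁻¹ = χ (-1) * gaussSum χ⁻¹ (stdAddChar (N := q)) := by
    have := gaussSum_mulShift_eq χ⁻¹ (stdAddChar (N := q)) (-1)
    rwa [Units.val_neg, Units.val_one, ← AddChar.inv_mulShift, inv_inv] at this
  have h6 : χ (-1) = χ⁻¹ (-1) := by
    rcases χ.even_or_odd with h | h <;> rw [MulChar.inv_apply_eq_inv', h] <;> norm_num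
  have h5 := star_gaussSum_eq χ (stdAddChar (N := q))
  have h7 : gaussSum χ stdAddChar * star (gaussSum χ stdAddChar) = (q : ℂ) := by
    rw [h5, ← h3, h4, h6]
    ring
  rw [← Complex.ofReal_inj]
  push_cast
  rw [← Complex.mul_conj']
  exact h7

theorem norm_sum_stdAddChar_le {q a : ℕ} [NeZero q] (ha : 0 < a) (haq : a < q) (x : ℕ) :
    ‖∑ n ∈ range x, stdAddChar ((a : ZMod q) * (n : ZMod q))‖ ≤
      (q : ℝ) / 2 * (1 / a + 1 / ((q - a : ℕ) : ℝ)) := by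
  have hq : (0 : ℝ) < q := by exact_mod_cast ha.trans haq
  have ha' : (0 : ℝ) < a := by exact_mod_cast ha
  have hqa : (0 : ℝ) < q - a := by
    have : (a : ℝ) < q := by exact_mod_cast haq
    linarith
  rw [Nat.cast_sub haq.le]
  set t : ℝ := a / q with ht
  have ht0 : 0 < t := by positivity
  have ht1 : 0 < 1 - t := by
    have : 1 - t = (q - a) / q := by rw [ht]; field_simp
    rw [this]; positivity
  have hz : stdAddChar (a : ZMod q) = Complex.exp (Complex.I * ((2 * π * t : ℝ) : ℂ)) := by
    have := stdAddChar_coe (N := q) a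
    rw [Int.cast_natCast] at this
    rw [this, ht]
    congr 1
    push_cast
    ring
  have hs : 2 * t * (1 - t) ≤ Real.sin (π * t) := by
    have hp := Real.pi_pos
    rcases le_total t (1 / 2) with h | h
    · have h1 := Real.mul_le_sin (x := π * t) (by positivity) (by nlinarith)
      have : 2 / π * (π * t) = 2 * t := by field_simp
      rw [this] at h1
      nlinarith
    · have h1 := Real.mul_le_sin (x := π * (1 - t)) (by positivity) (by nlinarith)
      have : 2 / π * (π * (1 - t)) = 2 * (1 - t) := by field_simp
      rw [this, show π * (1 - t) = π - π * t by ring, Real.sin_pi_sub] at h1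
      nlinarith
  have hd : 4 * t * (1 - t) ≤ ‖stdAddChar (a : ZMod q) - 1‖ := by
    rw [hz, Complex.norm_exp_I_mul_ofReal_sub_one]
    have : 2 * π * t / 2 = π * t := by ring
    rw [this, Real.norm_eq_abs]
    refine le_trans ?_ (le_abs_self _)
    linarith
  have hpos : 0 < 4 * t * (1 - t) := by positivity
  have hne : stdAddChar (a : ZMod q) ≠ 1 := by
    intro h
    rw [h, sub_self, norm_zero] at hd
    linarith
  have hsum : ∑ n ∈ range x, stdAddChar ((a : ZMod q) * (n : ZMod q)) =
      ∑ n ∈ range x, stdAddChar (a : ZMod q) ^ n := by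
    refine sum_congr rfl fun n _ => ?_
    rw [mul_comm, ← nsmul_eq_mul, AddChar.map_nsmul_eq_pow]
  rw [hsum, geom_sum_eq hne, norm_div]
  have hnum : ‖stdAddChar (a : ZMod q) ^ x - 1‖ ≤ 2 := by
    refine (norm_sub_le _ _).trans ?_
    rw [norm_pow, AddChar.norm_apply]
    norm_num
  calc _ ≤ 2 / (4 * t * (1 - t)) := by gcongr
    _ = _ := by
      have : (1 - t) = (q - a) / q := by rw [ht]; field_simp
      rw [this, ht]
      field_simp
      ring

/-- The Pólya–Vinogradov inequality. -/
theorem norm_sum_range_le {q : ℕ} [NeZero q] (hq : q ≠ 1) {χ : DirichletCharacter ℂ q}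
    (hχ : χ.IsPrimitive) (x : ℕ) :
    ‖∑ n ∈ range x, χ (n : ZMod q)‖ ≤ √q * (1 + Real.log q) := by
  have hq0 : (0 : ℝ) < q := by exact_mod_cast Nat.pos_of_ne_zero (NeZero.ne q)
  have hτ : ‖gaussSum χ stdAddChar‖ = √q := by
    rw [← norm_gaussSum_sq hχ, Real.sqrt_sq (norm_nonneg _)]
  have h1 : ∀ j : ZMod q, (q : ℂ) * χ j =
      gaussSum χ stdAddChar * ∑ a, χ⁻¹ (-a) * stdAddChar (a * j) := by
    intro j
    have := congrFun (dft_dft (χ : ZMod q → ℂ)) (-j)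
    simp only [neg_neg, smul_eq_mul] at this
    rw [← this, dft_apply, mul_sum]
    refine sum_congr rfl fun a _ => ?_
    rw [hχ.fourierTransform_eq_inv_mul_gaussSum, mul_neg, neg_neg, smul_eq_mul]
    ring
  have h2 : (q : ℂ) * ∑ n ∈ range x, χ (n : ZMod q) = gaussSum χ stdAddChar *
      ∑ a ∈ range q, χ⁻¹ (-(a : ZMod q)) * ∑ n ∈ range x, stdAddChar ((a : ZMod q) * (n : ZMod q)) := by
    rw [sum_range_natCast (fun a => χ⁻¹ (-a) * ∑ n ∈ range x, stdAddChar (a * (n : ZMod q))),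
      mul_sum, sum_congr rfl fun (n : ℕ) _ => h1 n, ← mul_sum, sum_comm]
    simp_rw [mul_sum]
  obtain ⟨r, rfl⟩ : ∃ r, q = r + 1 := ⟨q - 1, by have := NeZero.ne q; omega⟩
  have hχ0 : χ⁻¹ (-((0 : ℕ) : ZMod (r + 1))) = 0 := by
    rw [Nat.cast_zero, neg_zero]; exact map_zero' _ hq
  rw [sum_range_succ', hχ0, zero_mul, add_zero] at h2
  have h3 : ‖∑ a ∈ range r, χ⁻¹ (-((a + 1 : ℕ) : ZMod (r + 1))) *
      ∑ n ∈ range x, stdAddChar (((a + 1 : ℕ) : ZMod (r + 1)) * (n : ZMod (r + 1)))‖ ≤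
      ((r + 1 : ℕ) : ℝ) * (1 + Real.log ((r + 1 : ℕ) : ℝ)) := by
    calc _ ≤ ∑ a ∈ range r, ((r + 1 : ℕ) : ℝ) / 2 *
          (1 / ((a + 1 : ℕ) : ℝ) + 1 / ((r - 1 - a + 1 : ℕ) : ℝ)) := by
          refine norm_sum_le_of_le _ fun a ha => ?_
          have ha := mem_range.1 ha
          rw [norm_mul]
          have := norm_sum_stdAddChar_le (q := r + 1) (a := a + 1) (by omega) (by omega) x
          have e : r + 1 - (a + 1) = r - 1 - a + 1 := by omega
          rw [e] at this
          refine le_trans ?_ this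
          exact mul_le_of_le_one_left (norm_nonneg _) (norm_le_one _ _)
      _ = ((r + 1 : ℕ) : ℝ) * ∑ a ∈ range r, 1 / ((a + 1 : ℕ) : ℝ) := by
          rw [← mul_sum, sum_add_distrib, sum_range_reflect (fun a => 1 / ((a + 1 : ℕ) : ℝ))]
          ring
      _ = ((r + 1 : ℕ) : ℝ) * (harmonic r : ℝ) := by
          simp [harmonic]
      _ ≤ ((r + 1 : ℕ) : ℝ) * (1 + Real.log ((r + 1 : ℕ) : ℝ)) := by
          gcongr
          refine (harmonic_le_one_add_log r).trans ?_
          have hr : 0 < (r : ℝ) := by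
            have : r ≠ 0 := by omega
            exact_mod_cast Nat.pos_of_ne_zero this
          gcongr
          omega
  have h4 := congrArg norm h2
  rw [norm_mul, norm_mul, hτ, Complex.norm_natCast] at h4
  have h5 : ((r + 1 : ℕ) : ℝ) * ‖∑ n ∈ range x, χ (n : ZMod (r + 1))‖ ≤
      ((r + 1 : ℕ) : ℝ) * (√((r + 1 : ℕ) : ℝ) * (1 + Real.log ((r + 1 : ℕ) : ℝ))) := by
    rw [h4]
    calc _ ≤ √((r + 1 : ℕ) : ℝ) * (((r + 1 : ℕ) : ℝ) * (1 + Real.log ((r + 1 : ℕ) : ℝ))) := by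
          gcongr
      _ = _ := by ring
  exact le_of_mul_le_mul_left h5 hq0

end PolyaVinogradov

section Truncation

open Finset DirichletCharacter MeasureTheory Set Filter Asymptotics

/-- If the partial sums of `f` are bounded by `B` and vanish up to `X ≥ 1`, then `LSeries f` agrees
on `1 < re s` with a function holomorphic on `0 < re s`, small at `1 / 2`. -/
theorem exists_extension_of_bounded_sums {f : ℕ → ℂ} {B X : ℝ} (hX : 1 ≤ X)
    (hB : ∀ n, ‖∑ k ∈ Finset.Icc 1 n, f k‖ ≤ B) (h0 : ∀ n : ℕ, n ≤ X → f n = 0)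
    (hS : ∀ s : ℂ, 1 < s.re → LSeriesSummable f s) :
    ∃ F : ℂ → ℂ, DifferentiableOn ℂ F {s | 0 < s.re} ∧ (∀ s : ℂ, 1 < s.re → LSeries f s = F s) ∧
      ‖F (1 / 2)‖ ≤ B * X ^ (-(1 / 2) : ℝ) := by
  have hX0 : 0 < X := by linarith
  have hB0 : 0 ≤ B := (norm_nonneg _).trans (hB 0)
  set S : ℝ → ℂ := fun t => ∑ k ∈ Finset.Icc 1 ⌊t⌋₊, f k with hSdef
  have hSX : ∀ t ≤ X, S t = 0 := fun t ht => by
    refine Finset.sum_eq_zero fun k hk => h0 k ?_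
    have hk := Finset.mem_Icc.1 hk
    have h1 := Nat.le_floor_iff' (by omega) |>.1 hk.2
    exact h1.trans ht
  have hmeas : Measurable S :=
    (measurable_from_nat (f := fun n => ∑ k ∈ Finset.Icc 1 n, f k)).comp Nat.measurable_floor
  have hloc : LocallyIntegrableOn S (Ioi 0) := by
    refine LocallyIntegrable.locallyIntegrableOn ?_ _
    refine (locallyIntegrable_const B).mono hmeas.aestronglyMeasurable (Eventually.of_forall ?_)
    intro t
    rw [Real.norm_of_nonneg hB0]
    exact hB _
  refine ⟨fun s => s * mellin S (-s), ?_, ?_, ?_⟩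
  · intro s hs
    have hs : 0 < s.re := hs
    have h1 : DifferentiableAt ℂ (mellin S) (-s) := by
      refine mellin_differentiableAt_of_isBigO_rpow (a := 0) (b := -s.re - 1) hloc ?_ (by simpa) ?_
        (by simp)
      · simp only [neg_zero, Real.rpow_zero]
        exact IsBigO.of_bound B (Eventually.of_forall fun t => by simpa using hB _)
      · refine IsBigO.of_bound 0 ?_
        filter_upwards [Ioo_mem_nhdsGT hX0] with t ht
        rw [hSX t ht.2.le]
        simp
    have h2 : DifferentiableAt ℂ (fun s => mellin S (-s)) s :=
      DifferentiableAt.comp (g := mellin S) (f := fun s => -s) s h1 differentiableAt_id.neg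
    exact (differentiableAt_id.mul h2).differentiableWithinAt
  · intro s hs
    rw [LSeries_eq_mul_integral f le_rfl (by linarith) (hS s hs)
      (IsBigO.of_bound B (Eventually.of_forall fun n => by simpa using hB n))]
    congr 1
    rw [mellin, ← integral_indicator measurableSet_Ioi, ← integral_indicator measurableSet_Ioi]
    congr 1
    ext t
    by_cases ht : 1 < t
    · rw [indicator_of_mem (by exact ht), indicator_of_mem (by exact zero_lt_one.trans ht),
        smul_eq_mul, mul_comm, neg_add']
    · rw [indicator_of_notMem (by exact ht)]
      by_cases ht0 : 0 < t
      · rw [indicator_of_mem (by exact ht0), hSX t (by linarith), smul_zero]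
      · rw [indicator_of_notMem (by exact ht0)]
  · have hint : IntegrableOn (fun t : ℝ => B * t ^ (-(3 / 2) : ℝ)) (Ioi X) :=
      (integrableOn_Ioi_rpow_of_lt (by norm_num) hX0).const_mul B
    have h1 : ‖mellin S (-(1 / 2))‖ ≤ ∫ t in Ioi X, B * t ^ (-(3 / 2) : ℝ) := by
      rw [mellin, ← integral_indicator measurableSet_Ioi, ← integral_indicator measurableSet_Ioi]
      refine norm_integral_le_of_norm_le (hint.integrable_indicator measurableSet_Ioi)
        (Eventually.of_forall fun t => ?_)
      by_cases ht : X < t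
      · have ht0 : 0 < t := hX0.trans ht
        rw [indicator_of_mem (by exact ht0), indicator_of_mem (by exact ht), norm_smul,
          Complex.norm_cpow_eq_rpow_re_of_pos ht0, mul_comm]
        have : (-(1 / 2) - 1 : ℂ).re = (-(3 / 2) : ℝ) := by norm_num
        rw [this]
        gcongr
        exact hB _
      · rw [indicator_of_notMem (s := Ioi X) (by exact ht)]
        by_cases ht0 : 0 < t
        · rw [indicator_of_mem (by exact ht0), hSX t (by linarith), smul_zero, norm_zero]
        · rw [indicator_of_notMem (by exact ht0), norm_zero]
    rw [norm_mul]
    rw [integral_const_mul, integral_Ioi_rpow_of_lt (by norm_num) hX0] at h1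
    have e : (-(3 / 2) + 1 : ℝ) = -(1 / 2) := by norm_num
    rw [e] at h1
    have h2 : ‖(1 / 2 : ℂ)‖ = 1 / 2 := by norm_num
    rw [h2]
    calc _ ≤ 1 / 2 * (B * (-X ^ (-(1 / 2) : ℝ) / -(1 / 2))) := by gcongr
      _ = _ := by ring

theorem norm_LFunction_half_sub_sum_le {q : ℕ} [NeZero q] {χ : DirichletCharacter ℂ q}
    (hχ : χ ≠ 1) {B X : ℝ} (hX : 1 ≤ X) (hB : ∀ x, ‖∑ n ∈ range x, χ (n : ZMod q)‖ ≤ B) :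
    ‖LFunction χ (1 / 2) - ∑ n ∈ Finset.Icc 1 ⌊X⌋₊, χ (n : ZMod q) / (√n : ℂ)‖ ≤
      2 * B * X ^ (-(1 / 2) : ℝ) := by
  set N := ⌊X⌋₊ with hN
  set g : ℕ → ℂ := fun n => if n ≤ N then χ (n : ZMod q) else 0 with hg
  set f : ℕ → ℂ := fun n => if n ≤ N then 0 else χ (n : ZMod q) with hf
  have hfg : (fun n : ℕ => χ (n : ZMod q)) = g + f := by
    ext n
    simp only [hg, hf, Pi.add_apply]
    split_ifs <;> simp
  have hgs : ∀ s : ℂ, ∀ n ∉ Finset.Icc 1 N, LSeries.term g s n = 0 := by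
    intro s n hn
    rcases Nat.eq_zero_or_pos n with rfl | h
    · simp
    · have : ¬ n ≤ N := fun h' => hn (Finset.mem_Icc.2 ⟨h, h'⟩)
      rw [LSeries.term_of_ne_zero h.ne']
      simp [hg, this]
  have hgsum : ∀ s : ℂ, LSeriesSummable g s := fun s => summable_of_ne_finset_zero (hgs s)
  have hgL : ∀ s : ℂ, LSeries g s = ∑ n ∈ Finset.Icc 1 N, χ (n : ZMod q) / (n : ℂ) ^ s := by
    intro s
    rw [LSeries, tsum_eq_sum (hgs s)]
    refine Finset.sum_congr rfl fun n hn => ?_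
    have hn := Finset.mem_Icc.1 hn
    rw [LSeries.term_of_ne_zero (by omega)]
    simp [hg, hn.2]
  have hχs : ∀ s : ℂ, 1 < s.re → LSeriesSummable (fun n : ℕ => χ (n : ZMod q)) s :=
    fun s hs => ZMod.LSeriesSummable_of_one_lt_re _ hs
  have hfs : ∀ s : ℂ, 1 < s.re → LSeriesSummable f s := by
    intro s hs
    have : f = (fun n : ℕ => χ (n : ZMod q)) - g := by rw [hfg]; simp
    rw [this]
    exact (hχs s hs).sub (hgsum s)
  have hpart : ∀ n, ‖∑ k ∈ Finset.Icc 1 n, f k‖ ≤ 2 * B := by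
    intro n
    have hB0 : 0 ≤ B := (norm_nonneg _).trans (hB 0)
    have h1 : ∑ k ∈ Finset.Icc 1 n, f k = ∑ k ∈ Finset.Ico (N + 1) (n + 1), χ (k : ZMod q) := by
      simp only [hf, ← ite_not (p := _ ≤ N)]
      rw [← Finset.sum_filter]
      refine Finset.sum_congr ?_ fun _ _ => rfl
      ext k
      simp only [Finset.mem_filter, Finset.mem_Icc, Finset.mem_Ico]
      omega
    rw [h1]
    rcases le_total (N + 1) (n + 1) with h | h
    · rw [Finset.sum_Ico_eq_sub _ h]
      refine (norm_sub_le _ _).trans ?_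
      linarith [hB (N + 1), hB (n + 1)]
    · rw [Finset.Ico_eq_empty_of_le h]
      simpa using hB0
  obtain ⟨F, hFd, hFL, hFb⟩ := exists_extension_of_bounded_sums hX hpart (fun n hn => by
    simp [hf, hN, Nat.le_floor hn]) hfs
  have hopen : IsOpen {s : ℂ | 0 < s.re} := isOpen_lt continuous_const Complex.continuous_re
  have hsum : Differentiable ℂ fun s : ℂ =>
      ∑ n ∈ Finset.Icc 1 N, χ (n : ZMod q) / (n : ℂ) ^ s := by
    refine Differentiable.fun_sum fun n hn => ?_
    have hn : (n : ℂ) ≠ 0 := by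
      have := Finset.mem_Icc.1 hn
      exact_mod_cast (show n ≠ 0 by omega)
    intro s
    refine (differentiableAt_const _).div (differentiableAt_id.const_cpow (Or.inl hn)) ?_
    simp [Complex.cpow_eq_zero_iff, hn]
  have hL : AnalyticOnNhd ℂ (fun s => LFunction χ s -
      ∑ n ∈ Finset.Icc 1 N, χ (n : ZMod q) / (n : ℂ) ^ s) {s : ℂ | 0 < s.re} :=
    ((differentiable_LFunction hχ).sub hsum).differentiableOn.analyticOnNhd hopen
  have heq := hL.eqOn_of_preconnected_of_eventuallyEq (hFd.analyticOnNhd hopen)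
    (convex_halfSpace_re_gt 0).isPreconnected (z₀ := 2) (by simp) (by
      have h2 : {s : ℂ | 1 < s.re} ∈ nhds (2 : ℂ) :=
        (isOpen_lt continuous_const Complex.continuous_re).mem_nhds (by simp)
      filter_upwards [h2] with s hs
      have hs : 1 < s.re := hs
      rw [LFunction_eq_LSeries χ hs, hfg, LSeries_add (hgsum s) (hfs s hs), hgL, hFL s hs]
      simp)
  have h3 := heq (show (1 / 2 : ℂ) ∈ {s : ℂ | 0 < s.re} by simp)
  have h4 : ∀ n : ℕ, (n : ℂ) ^ (1 / 2 : ℂ) = (√n : ℂ) := by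
    intro n
    rw [Real.sqrt_eq_rpow, Complex.ofReal_cpow (by positivity)]
    norm_num
  simp only [h4] at h3
  rw [h3]
  exact hFb

end Truncation

section Congruences

open Finset DirichletCharacter ZMod
open scoped Classical

theorem sum_one_div_sqrt_le (n : ℕ) : ∑ j ∈ Icc 1 n, 1 / √(j : ℝ) ≤ 2 * √n := by
  induction n with
  | zero => simp
  | succ n ih =>
    rw [sum_Icc_succ_top (by omega)]
    have h0 : (0 : ℝ) ≤ n := by positivity
    have h1 : 0 < √((n + 1 : ℕ) : ℝ) := Real.sqrt_pos.2 (by positivity)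
    have h2 : √((n + 1 : ℕ) : ℝ) ^ 2 = n + 1 := by
      rw [Real.sq_sqrt (by positivity)]; push_cast; ring
    have h3 : √(n : ℝ) ^ 2 = n := Real.sq_sqrt h0
    have h4 : 1 / √((n + 1 : ℕ) : ℝ) ≤ 2 * √((n + 1 : ℕ) : ℝ) - 2 * √(n : ℝ) := by
      rw [div_le_iff₀ h1]
      nlinarith [sq_nonneg (√((n + 1 : ℕ) : ℝ) - √(n : ℝ))]
    linarith

theorem sum_dvd_one_div_sqrt_le {w K : ℕ} (hw : 0 < w) {e : ℕ → ℕ}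
    (he : Set.InjOn e (Icc 2 K)) (he1 : ∀ k ∈ Icc 2 K, 1 ≤ e k ∧ e k ≤ 2 * k) :
    ∑ k ∈ Icc 2 K with w ∣ e k, 1 / √(k : ℝ) ≤ 4 * √K / w := by
  have hw' : (0 : ℝ) < w := by exact_mod_cast hw
  calc ∑ k ∈ Icc 2 K with w ∣ e k, 1 / √(k : ℝ)
      ≤ ∑ k ∈ Icc 2 K with w ∣ e k, √2 * (1 / √(e k : ℝ)) := by
        refine sum_le_sum fun k hk => ?_
        have h := he1 k (mem_filter.1 hk).1
        have h1 : (0 : ℝ) < e k := by exact_mod_cast h.1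
        have h2 : (e k : ℝ) ≤ 2 * k := by exact_mod_cast h.2
        have h3 : (0 : ℝ) < k := by linarith
        rw [mul_one_div, div_le_div_iff₀ (Real.sqrt_pos.2 h3) (Real.sqrt_pos.2 h1), one_mul,
          ← Real.sqrt_mul two_pos.le]
        exact Real.sqrt_le_sqrt h2
    _ = ∑ i ∈ ({k ∈ Icc 2 K | w ∣ e k}).image (fun k => e k / w), √2 * (1 / √((i * w : ℕ) : ℝ)) := by
        rw [sum_image]
        · refine sum_congr rfl fun k hk => ?_
          rw [Nat.div_mul_cancel (mem_filter.1 hk).2]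
        · intro a ha b hb hab
          simp only [coe_filter, Set.mem_ofPred_eq] at ha hb
          refine he ha.1 hb.1 ?_
          rw [← Nat.div_mul_cancel ha.2, ← Nat.div_mul_cancel hb.2]
          exact congrArg (· * w) hab
    _ ≤ ∑ i ∈ Icc 1 (2 * K / w), √2 * (1 / √((i * w : ℕ) : ℝ)) := by
        refine sum_le_sum_of_subset_of_nonneg ?_ fun _ _ _ => by positivity
        intro i hi
        obtain ⟨k, hk, rfl⟩ := mem_image.1 hi
        have hk' := mem_filter.1 hk
        have h := he1 k hk'.1
        have hkK := (mem_Icc.1 hk'.1).2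
        refine mem_Icc.2 ⟨Nat.div_pos (Nat.le_of_dvd h.1 hk'.2) hw, Nat.div_le_div_right ?_⟩
        omega
    _ = √2 * (1 / √w) * ∑ i ∈ Icc 1 (2 * K / w), 1 / √(i : ℝ) := by
        rw [mul_sum]
        refine sum_congr rfl fun i _ => ?_
        rw [Nat.cast_mul, Real.sqrt_mul (by positivity)]
        field_simp
    _ ≤ √2 * (1 / √w) * (2 * √(2 * K / w)) := by
        gcongr
        refine (sum_one_div_sqrt_le _).trans ?_
        gcongr
        refine Nat.cast_div_le.trans ?_
        push_cast
        rfl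
    _ = 4 * √K / w := by
        rw [Real.sqrt_div (by positivity), Real.sqrt_mul two_pos.le]
        have h2 : √2 * √2 = 2 := Real.mul_self_sqrt two_pos.le
        have h3 : √(w : ℝ) * √(w : ℝ) = w := Real.mul_self_sqrt hw'.le
        have h4 : 0 < √(w : ℝ) := Real.sqrt_pos.2 hw'
        calc _ = (√2 * √2) * 2 * √K / (√w * √w) := by ring
          _ = _ := by rw [h2, h3]; ring

/-- Majorant of the sums of `χ k` and of `χ (-k)` over primitive `χ` modulo `q`. -/
noncomputable def congruenceWeight (q k : ℕ) : ℝ :=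
  ∑ w ∈ q.divisors, ((if w ∣ k - 1 then (w : ℝ) else 0) + if w ∣ k + 1 then (w : ℝ) else 0)

theorem congruenceWeight_nonneg (q k : ℕ) : 0 ≤ congruenceWeight q k :=
  sum_nonneg fun _ _ => by positivity

theorem sum_congruenceWeight_le (q K : ℕ) :
    ∑ k ∈ Icc 2 K, congruenceWeight q k * (1 / √(k : ℝ)) ≤ 8 * #q.divisors * √K := by
  simp only [congruenceWeight, sum_mul]
  rw [sum_comm]
  calc _ ≤ ∑ w ∈ q.divisors, 8 * √K := by
        refine sum_le_sum fun w hw => ?_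
        have hw0 : 0 < w := Nat.pos_of_mem_divisors hw
        have hw' : (0 : ℝ) < w := by exact_mod_cast hw0
        have h1 := sum_dvd_one_div_sqrt_le (K := K) hw0 (e := fun k => k - 1)
          (fun a ha b hb h => by
            have ha := mem_Icc.1 (mem_coe.1 ha)
            have hb := mem_Icc.1 (mem_coe.1 hb)
            simp only at h
            omega)
          (fun k hk => by have := mem_Icc.1 hk; omega)
        have h2 := sum_dvd_one_div_sqrt_le (K := K) hw0 (e := fun k => k + 1)
          (fun a _ b _ h => by simpa using h)
          (fun k hk => by have := mem_Icc.1 hk; omega)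
        rw [sum_filter] at h1 h2
        have h3 : ∑ k ∈ Icc 2 K, ((if w ∣ k - 1 then (w : ℝ) else 0) +
            if w ∣ k + 1 then (w : ℝ) else 0) * (1 / √(k : ℝ)) =
            w * ∑ k ∈ Icc 2 K, (if w ∣ k - 1 then 1 / √(k : ℝ) else 0) +
            w * ∑ k ∈ Icc 2 K, (if w ∣ k + 1 then 1 / √(k : ℝ) else 0) := by
          rw [mul_sum, mul_sum, ← sum_add_distrib]
          refine sum_congr rfl fun k _ => ?_
          split_ifs <;> ring
        rw [h3]
        calc _ ≤ w * (4 * √K / w) + w * (4 * √K / w) := by gcongr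
          _ = 8 * √K := by field_simp; ring
    _ = _ := by rw [sum_const, nsmul_eq_mul]; ring

theorem sum_product_le {F : ℕ → ℝ} (hF : ∀ k, 0 ≤ F k) {N M : ℕ} {D : ℝ}
    (hD : ∀ k, 1 ≤ k → k ≤ N * M → (#k.divisors : ℝ) ≤ D) :
    ∑ p ∈ Icc 1 N ×ˢ Icc 1 M with p.1 * p.2 ≠ 1, F (p.1 * p.2) ≤
      D * ∑ k ∈ Icc 2 (N * M), F k := by
  rw [← sum_fiberwise_of_maps_to (t := Icc 2 (N * M)) (g := fun p : ℕ × ℕ => p.1 * p.2), mul_sum]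
  · refine sum_le_sum fun k hk => ?_
    have hk := mem_Icc.1 hk
    rw [sum_congr rfl (g := fun _ => F k) fun p hp => by rw [(mem_filter.1 hp).2], sum_const,
      nsmul_eq_mul]
    refine mul_le_mul_of_nonneg_right ?_ (hF k)
    refine le_trans ?_ (hD k (by omega) hk.2)
    refine Nat.cast_le.2 (card_le_card_of_injOn Prod.fst ?_ ?_)
    · intro p hp
      have := (mem_filter.1 hp).2
      exact Nat.mem_divisors.2 ⟨⟨p.2, this.symm⟩, by omega⟩
    · intro p hp p' hp' h
      have h1 := (mem_filter.1 hp).2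
      have h2 := (mem_filter.1 hp').2
      have h0 : 0 < p.1 := by
        refine Nat.pos_of_ne_zero fun h0 => ?_
        rw [h0, zero_mul] at h1
        omega
      rw [← h2, ← h] at h1
      exact Prod.ext h (Nat.eq_of_mul_eq_mul_left h0 h1)
  · intro p hp
    simp only [mem_filter, mem_product, mem_Icc] at hp ⊢
    obtain ⟨⟨⟨h1, h2⟩, h3, h4⟩, h5⟩ := hp
    have := Nat.mul_pos h1 h3
    exact ⟨by omega, Nat.mul_le_mul h2 h4⟩

theorem norm_sum_primitive_add_le {q : ℕ} [NeZero q] {k : ℕ} (hk : 1 ≤ k) :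
    ‖∑ χ : DirichletCharacter ℂ q with χ.IsPrimitive, χ (k : ZMod q)‖ +
      ‖∑ χ : DirichletCharacter ℂ q with χ.IsPrimitive, χ (-(k : ZMod q))‖ ≤
      congruenceWeight q k := by
  by_cases h : IsCoprime (k : ℤ) (q : ℤ)
  · have h1 := norm_sum_primitive_le h
    have h2 := norm_sum_primitive_le h.neg_left
    push_cast at h1 h2
    rw [congruenceWeight, sum_add_distrib]
    refine add_le_add (h1.trans_eq ?_) (h2.trans_eq ?_)
    · refine sum_congr rfl fun w _ => ?_
      have : ((w : ℤ) ∣ (k : ℤ) - 1) ↔ w ∣ k - 1 := by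
        rw [← Int.natCast_dvd_natCast, Nat.cast_sub hk, Nat.cast_one]
      simp only [this]
    · refine sum_congr rfl fun w _ => ?_
      have : ((w : ℤ) ∣ -(k : ℤ) - 1) ↔ w ∣ k + 1 := by
        rw [← Int.natCast_dvd_natCast, ← dvd_neg]
        push_cast
        ring_nf
      simp only [this]
  · have h0 : ∀ χ : DirichletCharacter ℂ q, χ (k : ZMod q) = 0 := fun χ => by
      have := (χ.apply_eq_zero_iff k).2 h
      simpa using this
    have h1 : ∀ χ : DirichletCharacter ℂ q, χ (-(k : ZMod q)) = 0 := fun χ => by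
      rw [neg_eq_neg_one_mul, map_mul, h0, mul_zero]
    simp only [h0, h1, sum_const_zero, norm_zero, add_zero]
    exact congruenceWeight_nonneg q k

theorem two_mul_sum_even {q : ℕ} [NeZero q] (a : ZMod q) :
    2 * ∑ χ : DirichletCharacter ℂ q with χ.IsPrimitive ∧ χ.Even, χ a =
      ∑ χ : DirichletCharacter ℂ q with χ.IsPrimitive, χ a +
        ∑ χ : DirichletCharacter ℂ q with χ.IsPrimitive, χ (-a) := by
  rw [← sum_add_distrib, mul_sum, ← filter_filter, sum_filter]
  refine sum_congr rfl fun χ _ => ?_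
  rw [neg_eq_neg_one_mul, map_mul]
  rcases χ.even_or_odd with h | h
  · rw [if_pos h, show χ (-1) = 1 from h]; ring
  · rw [if_neg fun h' => χ.not_even_and_odd ⟨h', h⟩, show χ (-1) = -1 from h]; ring

end Congruences

section FunctionalEquation

open Finset DirichletCharacter
open ZMod (stdAddChar stdAddChar_coe)
open scoped Classical

theorem abs_acoef_le_one {y : ℝ} (hy : 1 < y) {m : ℕ} (hm : 1 ≤ m) (hmy : (m : ℝ) ≤ y) :
    |acoef y m| ≤ 1 := by
  have hm0 : (0 : ℝ) < m := by exact_mod_cast hm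
  have hm1 : (1 : ℝ) ≤ m := by exact_mod_cast hm
  have hlog : 0 < Real.log y := Real.log_pos hy
  have h1 : |((ArithmeticFunction.moebius m : ℤ) : ℝ)| ≤ 1 := by
    exact_mod_cast ArithmeticFunction.abs_moebius_le_one
  have h2 : 0 ≤ Real.log (y / m) := Real.log_nonneg ((one_le_div hm0).2 hmy)
  have h3 : Real.log (y / m) ≤ Real.log y :=
    Real.log_le_log (by positivity) (div_le_self (by positivity) hm1)
  rw [acoef, abs_div, abs_mul, abs_of_pos hlog, abs_of_nonneg h2, div_le_one hlog]
  calc _ ≤ 1 * Real.log (y / m) := mul_le_mul_of_nonneg_right h1 h2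
    _ ≤ Real.log y := by rwa [one_mul]

theorem acoef_one {y : ℝ} (hy : 1 < y) : acoef y 1 = 1 := by
  have hlog : 0 < Real.log y := Real.log_pos hy
  simp [acoef, hlog.ne']

theorem gaussSum'_eq {q : ℕ} [NeZero q] (χ : DirichletCharacter ℂ q) :
    gaussSum' q χ = gaussSum χ stdAddChar := by
  rw [gaussSum', gaussSum, ← sum_range_natCast]
  refine sum_congr rfl fun n _ => ?_
  have := stdAddChar_coe (N := q) n
  rw [Int.cast_natCast] at this
  rw [this]
  push_cast
  rfl

theorem even_inv {q : ℕ} {χ : DirichletCharacter ℂ q} (hχ : χ.Even) : χ⁻¹.Even := by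
  rw [DirichletCharacter.Even, MulChar.inv_apply_eq_inv', hχ, inv_one]

theorem star_gaussSum_of_even {q : ℕ} [NeZero q] {χ : DirichletCharacter ℂ q} (hχ : χ.Even) :
    star (gaussSum χ stdAddChar) = gaussSum χ⁻¹ (stdAddChar (N := q)) := by
  have h := gaussSum_mulShift_eq χ⁻¹ (stdAddChar (N := q)) (-1)
  rw [Units.val_neg, Units.val_one, ← AddChar.inv_mulShift, inv_inv, show χ (-1) = 1 from hχ,
    one_mul] at h
  rw [star_gaussSum_eq, h]

theorem LFunction_inv_half {q : ℕ} [NeZero q] {χ : DirichletCharacter ℂ q}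
    (hp : χ.IsPrimitive) (he : χ.Even) :
    LFunction χ⁻¹ (1 / 2) = star (gaussSum' q χ) / (√q : ℂ) * LFunction χ (1 / 2) := by
  have h := (isPrimitive_inv hp).completedLFunction_one_sub (1 / 2)
  have h0 : (1 / 2 : ℂ) ≠ 0 := by norm_num
  rw [inv_inv, rootNumber, if_pos (even_inv he), show (1 : ℂ) - 1 / 2 = 1 / 2 by norm_num, sub_self,
    Complex.cpow_zero, pow_zero, div_one, one_mul] at h
  have hs : ((q : ℂ) ^ (1 / 2 : ℂ)) = (√q : ℂ) := by
    rw [Real.sqrt_eq_rpow, Complex.ofReal_cpow (by positivity)]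
    norm_num
  rw [LFunction_eq_completed_div_gammaFactor _ _ (.inl h0),
    LFunction_eq_completed_div_gammaFactor χ _ (.inl h0), (even_inv he).gammaFactor_def,
    he.gammaFactor_def, h, hs, gaussSum'_eq, star_gaussSum_of_even he]
  ring

theorem norm_sum_primitive_neg_one_le {q : ℕ} [NeZero q] :
    ‖∑ χ : DirichletCharacter ℂ q with χ.IsPrimitive, χ (-1)‖ ≤ 3 := by
  have h := norm_sum_primitive_le (q := q) (k := -1) (isCoprime_one_left.neg_left)
  push_cast at h
  refine h.trans ?_
  rw [← sum_filter]
  calc _ ≤ ∑ w ∈ Nat.divisors 2, (w : ℝ) := by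
        refine sum_le_sum_of_subset_of_nonneg ?_ fun _ _ _ => by positivity
        intro w hw
        have := (mem_filter.1 hw).2
        norm_num at this
        exact Nat.mem_divisors.2 ⟨by exact_mod_cast this, by norm_num⟩
    _ = 3 := by
        rw [Nat.Prime.sum_divisors Nat.prime_two]; norm_num

end FunctionalEquation

section TwistedMoment

open Finset DirichletCharacter
open scoped Classical

/-- The Dirichlet polynomial `∑_{m ≤ M} a(m) χ(m) m^{-1/2}`. -/
noncomputable def mollifierPoly {q : ℕ} (a : ℕ → ℝ) (M : ℕ) (χ : DirichletCharacter ℂ q) : ℂ :=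
  ∑ m ∈ Icc 1 M, (a m : ℂ) * χ (m : ZMod q) / (√m : ℂ)

theorem norm_mollifierPoly_le {q : ℕ} {a : ℕ → ℝ} {M : ℕ} (ha : ∀ m ∈ Icc 1 M, |a m| ≤ 1)
    (χ : DirichletCharacter ℂ q) : ‖mollifierPoly a M χ‖ ≤ 2 * √M := by
  refine (norm_sum_le _ _).trans (le_trans ?_ (sum_one_div_sqrt_le M))
  refine sum_le_sum fun m hm => ?_
  rw [norm_div, norm_mul, Complex.norm_real, Complex.norm_real, Real.norm_eq_abs, Real.norm_eq_abs,
    abs_of_nonneg (Real.sqrt_nonneg _)]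
  gcongr
  exact mul_le_one₀ (ha m hm) (norm_nonneg _) (χ.norm_le_one _)

theorem norm_sum_even_mul_sub_le {q : ℕ} [NeZero q] {a : ℕ → ℝ} {N M : ℕ} (hN : 1 ≤ N)
    (hM : 1 ≤ M) (ha : ∀ m ∈ Icc 1 M, |a m| ≤ 1) (ha1 : a 1 = 1) {D : ℝ}
    (hD : ∀ k, 1 ≤ k → k ≤ N * M → (#k.divisors : ℝ) ≤ D) :
    ‖2 * ∑ χ : DirichletCharacter ℂ q with χ.IsPrimitive ∧ χ.Even,
        (∑ n ∈ Icc 1 N, χ (n : ZMod q) / (√n : ℂ)) * mollifierPoly a M χ -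
        (#{χ : DirichletCharacter ℂ q | χ.IsPrimitive} : ℂ)‖ ≤
      3 + 8 * D * #q.divisors * √(N * M : ℕ) := by
  have key : 2 * ∑ χ : DirichletCharacter ℂ q with χ.IsPrimitive ∧ χ.Even,
        (∑ n ∈ Icc 1 N, χ (n : ZMod q) / (√n : ℂ)) * mollifierPoly a M χ =
      ∑ p ∈ Icc 1 N ×ˢ Icc 1 M, (a p.2 : ℂ) / (√(p.1 * p.2 : ℕ) : ℂ) *
        (2 * ∑ χ : DirichletCharacter ℂ q with χ.IsPrimitive ∧ χ.Even,
          χ ((p.1 * p.2 : ℕ) : ZMod q)) := by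
    simp only [mollifierPoly, sum_mul_sum]
    simp only [← sum_product' (Icc 1 N) (Icc 1 M)]
    rw [sum_comm, mul_sum]
    refine sum_congr rfl fun p _ => ?_
    rw [mul_left_comm]
    congr 1
    rw [mul_sum]
    refine sum_congr rfl fun χ _ => ?_
    rw [Nat.cast_mul p.1 p.2, Nat.cast_mul p.1 p.2, Real.sqrt_mul (by positivity), map_mul,
      Complex.ofReal_mul]
    ring
  have hone : ((Icc 1 N ×ˢ Icc 1 M).filter fun p => p.1 * p.2 = 1) = {(1, 1)} := by
    ext ⟨n, m⟩
    simp only [mem_filter, mem_product, mem_Icc, mem_singleton, mul_eq_one, Prod.mk.injEq]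
    constructor
    · exact fun h => h.2
    · rintro ⟨rfl, rfl⟩
      exact ⟨⟨⟨le_rfl, hN⟩, le_rfl, hM⟩, rfl, rfl⟩
  rw [key, ← sum_filter_add_sum_filter_not _ fun p : ℕ × ℕ => p.1 * p.2 = 1, hone, sum_singleton]
  have hmain : (a (1, 1).2 : ℂ) / (√((1, 1).1 * (1, 1).2 : ℕ) : ℂ) *
        (2 * ∑ χ : DirichletCharacter ℂ q with χ.IsPrimitive ∧ χ.Even,
          χ (((1, 1).1 * (1, 1).2 : ℕ) : ZMod q)) =
      (#{χ : DirichletCharacter ℂ q | χ.IsPrimitive} : ℂ) +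
        ∑ χ : DirichletCharacter ℂ q with χ.IsPrimitive, χ (-1) := by
    rw [two_mul_sum_even]
    simp [ha1]
  rw [hmain, add_assoc, add_sub_cancel_left]
  refine (norm_add_le _ _).trans (add_le_add norm_sum_primitive_neg_one_le ?_)
  have hD0 : 0 ≤ D := (Nat.cast_nonneg _).trans (hD 1 le_rfl (Nat.mul_pos hN hM))
  calc _ ≤ ∑ p ∈ Icc 1 N ×ˢ Icc 1 M with p.1 * p.2 ≠ 1,
        congruenceWeight q (p.1 * p.2) * (1 / √(p.1 * p.2 : ℕ)) := by
        refine (norm_sum_le _ _).trans (sum_le_sum fun p hp => ?_)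
        obtain ⟨h1, h2⟩ := mem_product.1 (mem_filter.1 hp).1
        rw [norm_mul, mul_comm, two_mul_sum_even]
        refine mul_le_mul ((norm_add_le _ _).trans (norm_sum_primitive_add_le ?_)) ?_
          (norm_nonneg _) (congruenceWeight_nonneg _ _)
        · exact Nat.mul_pos (mem_Icc.1 h1).1 (mem_Icc.1 h2).1
        · rw [norm_div, Complex.norm_real, Complex.norm_real, Real.norm_eq_abs, Real.norm_eq_abs,
            abs_of_nonneg (Real.sqrt_nonneg _)]
          gcongr
          exact ha _ h2
    _ ≤ D * ∑ k ∈ Icc 2 (N * M), congruenceWeight q k * (1 / √k) :=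
        sum_product_le (F := fun k => congruenceWeight q k * (1 / √k))
          (fun k => mul_nonneg (congruenceWeight_nonneg _ _) (by positivity)) hD
    _ ≤ D * (8 * #q.divisors * √(N * M : ℕ)) := by
        gcongr
        exact sum_congruenceWeight_le _ _
    _ = _ := by ring

theorem ne_one_of_isPrimitive {q : ℕ} [NeZero q] {χ : DirichletCharacter ℂ q} (hq : q ≠ 1)
    (hχ : χ.IsPrimitive) : χ ≠ 1 := by
  rintro rfl
  rw [isPrimitive_def, conductor_one] at hχ
  exact hq hχ.symm

/-- The first moment of `L(1/2, χ)` twisted by a Dirichlet polynomial. -/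
theorem norm_sum_LFunction_mul_sub_le {q : ℕ} [NeZero q] (hq : q ≠ 1) {a : ℕ → ℝ} {M : ℕ}
    (hM : 1 ≤ M) (ha : ∀ m ∈ Icc 1 M, |a m| ≤ 1) (ha1 : a 1 = 1) {X D : ℝ} (hX : 1 ≤ X)
    (hD : ∀ k, 1 ≤ k → k ≤ ⌊X⌋₊ * M → (#k.divisors : ℝ) ≤ D) :
    ‖2 * ∑ χ : DirichletCharacter ℂ q with χ.IsPrimitive ∧ χ.Even,
        LFunction χ (1 / 2) * mollifierPoly a M χ -
        (#{χ : DirichletCharacter ℂ q | χ.IsPrimitive} : ℂ)‖ ≤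
      #{χ : DirichletCharacter ℂ q | χ.IsPrimitive} *
        (8 * (√q * (1 + Real.log q)) * X ^ (-(1 / 2) : ℝ) * √M) +
      (3 + 8 * D * #q.divisors * √(⌊X⌋₊ * M : ℕ)) := by
  set B := √q * (1 + Real.log q) with hB
  have hB0 : 0 ≤ B := by
    have : 0 ≤ Real.log q := Real.log_natCast_nonneg q
    positivity
  have h1 := norm_sum_even_mul_sub_le (q := q) ((Nat.one_le_floor_iff X).2 hX) hM ha ha1 hD
  rw [show 2 * ∑ χ : DirichletCharacter ℂ q with χ.IsPrimitive ∧ χ.Even,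
        LFunction χ (1 / 2) * mollifierPoly a M χ =
      2 * ∑ χ : DirichletCharacter ℂ q with χ.IsPrimitive ∧ χ.Even,
        (LFunction χ (1 / 2) - ∑ n ∈ Icc 1 ⌊X⌋₊, χ (n : ZMod q) / (√n : ℂ)) *
          mollifierPoly a M χ +
      2 * ∑ χ : DirichletCharacter ℂ q with χ.IsPrimitive ∧ χ.Even,
        (∑ n ∈ Icc 1 ⌊X⌋₊, χ (n : ZMod q) / (√n : ℂ)) * mollifierPoly a M χ by
      rw [← mul_add, ← sum_add_distrib]
      simp only [sub_mul, sub_add_cancel], add_sub_assoc]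
  refine (norm_add_le _ _).trans (add_le_add ?_ h1)
  calc _ ≤ 2 * ∑ χ : DirichletCharacter ℂ q with χ.IsPrimitive ∧ χ.Even,
        2 * B * X ^ (-(1 / 2) : ℝ) * (2 * √M) := by
        rw [norm_mul, Complex.norm_ofNat]
        refine mul_le_mul_of_nonneg_left ((norm_sum_le _ _).trans (sum_le_sum fun χ hχ => ?_))
          two_pos.le
        have hp := (mem_filter.1 hχ).2.1
        rw [norm_mul]
        refine mul_le_mul ?_ (norm_mollifierPoly_le ha χ) (norm_nonneg _) (by positivity)
        exact norm_LFunction_half_sub_sum_le (ne_one_of_isPrimitive hq hp) hX fun x =>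
          norm_sum_range_le hq hp x
    _ ≤ 2 * (#{χ : DirichletCharacter ℂ q | χ.IsPrimitive} •
        (2 * B * X ^ (-(1 / 2) : ℝ) * (2 * √M))) := by
        rw [sum_const]
        gcongr
        exact fun h => h.1
    _ = _ := by rw [nsmul_eq_mul]; ring

theorem sum_even_inv {q : ℕ} [NeZero q] (f : DirichletCharacter ℂ q → ℂ) :
    ∑ χ : DirichletCharacter ℂ q with χ.IsPrimitive ∧ χ.Even, f χ⁻¹ =
      ∑ χ : DirichletCharacter ℂ q with χ.IsPrimitive ∧ χ.Even, f χ := by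
  have h : ∀ χ : DirichletCharacter ℂ q, χ.IsPrimitive ∧ χ.Even →
      χ⁻¹.IsPrimitive ∧ χ⁻¹.Even := fun χ h => ⟨isPrimitive_inv h.1, even_inv h.2⟩
  refine sum_nbij' (fun χ => χ⁻¹) (fun χ => χ⁻¹) ?_ ?_ ?_ ?_ ?_ <;>
    simp +contextual [h]

theorem sum_LFunction_mul_mollifier {q : ℕ} [NeZero q] (θ₁ θ₂ c₁ c₂ : ℝ) :
    ∑ᶠ (χ : DirichletCharacter ℂ q) (_ : χ.IsPrimitive ∧ χ.Even),
        Lval q χ (1 / 2) * mollifier q θ₁ θ₂ c₁ c₂ χ =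
      c₁ * ∑ χ : DirichletCharacter ℂ q with χ.IsPrimitive ∧ χ.Even,
        LFunction χ (1 / 2) * mollifierPoly (acoef ((q : ℝ) ^ θ₁)) ⌊(q : ℝ) ^ θ₁⌋₊ χ +
      c₂ * ∑ χ : DirichletCharacter ℂ q with χ.IsPrimitive ∧ χ.Even,
        LFunction χ (1 / 2) * mollifierPoly (acoef ((q : ℝ) ^ θ₂)) ⌊(q : ℝ) ^ θ₂⌋₊ χ := by
  refine (finsum_mem_eq_finite_toFinset_sum _
    (Set.toFinite {χ : DirichletCharacter ℂ q | χ.IsPrimitive ∧ χ.Even})).trans ?_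
  rw [← sum_even_inv fun χ => LFunction χ (1 / 2) *
      mollifierPoly (acoef ((q : ℝ) ^ θ₂)) ⌊(q : ℝ) ^ θ₂⌋₊ χ, mul_sum, mul_sum,
    ← sum_add_distrib]
  refine sum_congr (by ext; simp) fun χ hχ => ?_
  obtain ⟨hp, he⟩ := (mem_filter.1 hχ).2
  rw [LFunction_inv_half hp he, Lval, dif_neg (NeZero.ne q), mollifier]
  have : ∀ m : ℕ, (starRingEnd ℂ) (χ m) = χ⁻¹ m := fun m => MulChar.star_apply' χ m
  simp only [this, mollifierPoly, starRingEnd_apply]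
  ring

end TwistedMoment

section Asymptotics

open Finset DirichletCharacter
open scoped Classical

theorem exists_norm_moment_sub_one_le {ε : ℝ} (hε : 0 < ε) :
    ∃ C : ℝ, 0 < C ∧ ∀ (q : ℕ) [NeZero q], 3 ≤ q → q % 4 ≠ 2 →
      ∀ θ : ℝ, 0 < θ → θ ≤ 1 / 2 - ε →
      ‖2 / (#{χ : DirichletCharacter ℂ q | χ.IsPrimitive} : ℂ) *
        ∑ χ : DirichletCharacter ℂ q with χ.IsPrimitive ∧ χ.Even,
          LFunction χ (1 / 2) * mollifierPoly (acoef ((q : ℝ) ^ θ)) ⌊(q : ℝ) ^ θ⌋₊ χ - 1‖ ≤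
        C * (q : ℝ) ^ (-(ε / 8)) := by
  obtain ⟨C₁, hC₁, hdiv⟩ := exists_card_divisors_le (η := ε / 20) (by positivity)
  refine ⟨8 * (1 + 1 / (ε / 20)) + 3 * C₁ ^ 2 + 8 * C₁ ^ 4, by positivity,
    fun q _ hq hq4 θ hθ hθ' => ?_⟩
  have hQ0 : (0 : ℝ) < q := by exact_mod_cast (by omega : 0 < q)
  have hQ1 : (1 : ℝ) < q := by exact_mod_cast (by omega : 1 < q)
  have hy : 1 < (q : ℝ) ^ θ := Real.one_lt_rpow hQ1 hθ
  set M := ⌊(q : ℝ) ^ θ⌋₊ with hMdef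
  have hM : 1 ≤ M := (Nat.one_le_floor_iff _).2 hy.le
  have hMle : (M : ℝ) ≤ (q : ℝ) ^ (1 / 2 - ε) :=
    (Nat.floor_le (by positivity)).trans (Real.rpow_le_rpow_of_exponent_le hQ1.le hθ')
  set X : ℝ := (q : ℝ) ^ (3 / 2 - ε / 2) with hXdef
  have hX : 1 ≤ X := Real.one_le_rpow hQ1.le (by linarith)
  have hK : ((⌊X⌋₊ * M : ℕ) : ℝ) ≤ (q : ℝ) ^ (2 - 3 * ε / 2) := by
    rw [Nat.cast_mul]
    calc _ ≤ X * (q : ℝ) ^ (1 / 2 - ε) := by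
          gcongr
          exact Nat.floor_le (by positivity)
      _ = _ := by rw [hXdef, ← Real.rpow_add hQ0]; ring_nf
  have hD : ∀ k, 1 ≤ k → k ≤ ⌊X⌋₊ * M → (#k.divisors : ℝ) ≤ C₁ * (q : ℝ) ^ (ε / 10) := by
    intro k hk hkK
    refine (hdiv k hk).trans ?_
    have h1 : (k : ℝ) ≤ (q : ℝ) ^ (2 : ℝ) :=
      ((Nat.cast_le.2 hkK).trans hK).trans
        (Real.rpow_le_rpow_of_exponent_le hQ1.le (by linarith))
    have h2 : (k : ℝ) ^ (ε / 20) ≤ ((q : ℝ) ^ (2 : ℝ)) ^ (ε / 20) :=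
      Real.rpow_le_rpow (by positivity) h1 (by positivity)
    rw [← Real.rpow_mul hQ0.le, show 2 * (ε / 20) = ε / 10 by ring] at h2
    gcongr
  have core := norm_sum_LFunction_mul_sub_le (q := q) (by omega) hM
    (a := acoef ((q : ℝ) ^ θ)) (fun m hm => abs_acoef_le_one hy (mem_Icc.1 hm).1
      ((Nat.cast_le.2 (mem_Icc.1 hm).2).trans (Nat.floor_le (by positivity))))
    (acoef_one hy) hX hD
  set φ : ℝ := ((#{χ : DirichletCharacter ℂ q | χ.IsPrimitive} : ℕ) : ℝ) with hφ
  have hφc : (#{χ : DirichletCharacter ℂ q | χ.IsPrimitive} : ℂ) = (φ : ℂ) := by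
    rw [hφ]; norm_cast
  rw [hφc] at core ⊢
  have hdq := hdiv q (by omega)
  have hqφ : (q : ℝ) ≤ φ * (C₁ * (q : ℝ) ^ (ε / 20)) ^ 2 :=
    (le_card_primitive hq4).trans (by gcongr)
  have hφ0 : 0 < φ := by
    by_contra! h
    have := mul_nonpos_of_nonpos_of_nonneg h (sq_nonneg (C₁ * (q : ℝ) ^ (ε / 20)))
    linarith
  have hφinv : 1 / φ ≤ C₁ ^ 2 * (q : ℝ) ^ (ε / 10 - 1) := by
    rw [div_le_iff₀ hφ0, Real.rpow_sub_one hQ0.ne', mul_div_assoc', div_mul_eq_mul_div,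
      one_le_div hQ0]
    refine hqφ.trans_eq ?_
    rw [mul_pow, ← Real.rpow_natCast ((q : ℝ) ^ (ε / 20)), ← Real.rpow_mul hQ0.le]
    push_cast
    ring_nf
  have hlog : 1 + Real.log q ≤ (1 + 1 / (ε / 20)) * (q : ℝ) ^ (ε / 20) := by
    have h1 := Real.log_le_rpow_div hQ0.le (ε := ε / 20) (by positivity)
    have h2 : 1 ≤ (q : ℝ) ^ (ε / 20) := Real.one_le_rpow hQ1.le (by positivity)
    rw [add_mul, one_mul, div_mul_eq_mul_div, one_mul]
    exact add_le_add h2 h1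
  have hsqrt : ∀ {x e : ℝ}, x ≤ (q : ℝ) ^ e → √x ≤ (q : ℝ) ^ (e / 2) := fun {x e} h => by
    refine (Real.sqrt_le_sqrt h).trans_eq ?_
    rw [Real.sqrt_eq_rpow, ← Real.rpow_mul hQ0.le]
    ring_nf
  have htail : 8 * (√q * (1 + Real.log q)) * X ^ (-(1 / 2) : ℝ) * √M ≤
      8 * (1 + 1 / (ε / 20)) * (q : ℝ) ^ (-(ε / 8)) := by
    calc _ ≤ 8 * ((q : ℝ) ^ ((1 : ℝ) / 2) * ((1 + 1 / (ε / 20)) * (q : ℝ) ^ (ε / 20))) *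
          (q : ℝ) ^ ((3 / 2 - ε / 2) * (-(1 / 2))) * (q : ℝ) ^ ((1 / 2 - ε) / 2) := by
          rw [hXdef, ← Real.rpow_mul hQ0.le]
          have := hsqrt (x := q) (e := 1) (by rw [Real.rpow_one])
          have := hsqrt hMle
          have := Real.log_natCast_nonneg q
          gcongr
      _ = 8 * (1 + 1 / (ε / 20)) * ((q : ℝ) ^ ((1 : ℝ) / 2) * (q : ℝ) ^ (ε / 20) *
          (q : ℝ) ^ ((3 / 2 - ε / 2) * (-(1 / 2))) * (q : ℝ) ^ ((1 / 2 - ε) / 2)) := by ring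
      _ ≤ _ := by
          simp only [← Real.rpow_add hQ0]
          refine mul_le_mul_of_nonneg_left
            (Real.rpow_le_rpow_of_exponent_le hQ1.le (by linarith)) (by positivity)
  have hmain : (3 + 8 * (C₁ * (q : ℝ) ^ (ε / 10)) * #q.divisors * √(⌊X⌋₊ * M : ℕ)) * (1 / φ) ≤
      (3 * C₁ ^ 2 + 8 * C₁ ^ 4) * (q : ℝ) ^ (-(ε / 8)) := by
    calc _ ≤ (3 + 8 * (C₁ * (q : ℝ) ^ (ε / 10)) * (C₁ * (q : ℝ) ^ (ε / 20)) *
          (q : ℝ) ^ ((2 - 3 * ε / 2) / 2)) * (C₁ ^ 2 * (q : ℝ) ^ (ε / 10 - 1)) := by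
          have := hsqrt hK
          gcongr
      _ = 3 * C₁ ^ 2 * (q : ℝ) ^ (ε / 10 - 1) + 8 * C₁ ^ 4 * ((q : ℝ) ^ (ε / 10) *
          (q : ℝ) ^ (ε / 20) * (q : ℝ) ^ ((2 - 3 * ε / 2) / 2) * (q : ℝ) ^ (ε / 10 - 1)) := by
          ring
      _ ≤ 3 * C₁ ^ 2 * (q : ℝ) ^ (-(ε / 8)) + 8 * C₁ ^ 4 * (q : ℝ) ^ (-(ε / 8)) := by
          simp only [← Real.rpow_add hQ0]
          refine add_le_add ?_ ?_ <;> refine mul_le_mul_of_nonneg_left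
            (Real.rpow_le_rpow_of_exponent_le hQ1.le (by linarith)) (by positivity)
      _ = _ := by ring
  have hφ' : (φ : ℂ) ≠ 0 := by exact_mod_cast hφ0.ne'
  rw [show ∀ S : ℂ, 2 / (φ : ℂ) * S - 1 = (2 * S - φ) * ((1 / φ : ℝ) : ℂ) from fun S => by
    push_cast; field_simp, norm_mul, Complex.norm_real, Real.norm_of_nonneg (by positivity)]
  refine (mul_le_mul_of_nonneg_right core (by positivity)).trans ?_
  rw [add_mul, mul_right_comm, mul_one_div_cancel hφ0.ne', one_mul]
  refine (add_le_add htail hmain).trans_eq ?_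
  ring

end Asymptotics

end MollifiedMoment

/-- The mollified first moment over even primitive characters equals `c₁ + c₂ + O(q^{-δ})`. -/
theorem mollified_first_moment (c₁ c₂ : ℝ) (hc₁ : 0 < c₁) (hc₂ : 0 < c₂)
    (ε : ℝ) (hε : 0 < ε) (hε' : ε < 1/2) :
    ∃ δ : ℝ, 0 < δ ∧ ∃ C : ℝ, 0 < C ∧ ∀ q : ℕ, 3 ≤ q → q % 4 ≠ 2 →
      ∀ θ₁ θ₂ : ℝ, 0 < θ₁ → θ₁ ≤ 1/2 - ε → 0 < θ₂ → θ₂ ≤ 1/2 - ε →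
      ‖(2 / (phistar q : ℂ)) *
          (∑ᶠ (χ : DirichletCharacter ℂ q) (_ : χ.IsPrimitive ∧ χ.Even),
            Lval q χ (1/2) * mollifier q θ₁ θ₂ c₁ c₂ χ) - (c₁ + c₂ : ℝ)‖ ≤
        C * (q : ℝ) ^ (-δ) := by
  obtain ⟨C, hC, h⟩ := MollifiedMoment.exists_norm_moment_sub_one_le hε
  refine ⟨ε / 8, by positivity, (c₁ + c₂) * C, by positivity,
    fun q hq hq4 θ₁ θ₂ hθ₁ hθ₁' hθ₂ hθ₂' => ?_⟩
  have : NeZero q := ⟨by omega⟩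
  have h₁ := h q hq hq4 θ₁ hθ₁ hθ₁'
  have h₂ := h q hq hq4 θ₂ hθ₂ hθ₂'
  rw [MollifiedMoment.sum_LFunction_mul_mollifier, phistar,
    ← MollifiedMoment.card_primitive_eq_phistar]
  rw [show ∀ z S T : ℂ, z * (c₁ * S + c₂ * T) - ((c₁ + c₂ : ℝ) : ℂ) =
    c₁ * (z * S - 1) + c₂ * (z * T - 1) from fun z S T => by push_cast; ring]
  refine (norm_add_le _ _).trans ?_
  rw [norm_mul, norm_mul, Complex.norm_real, Complex.norm_real, Real.norm_of_nonneg hc₁.le,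
    Real.norm_of_nonneg hc₂.le]
  calc _ ≤ c₁ * (C * (q : ℝ) ^ (-(ε / 8))) + c₂ * (C * (q : ℝ) ^ (-(ε / 8))) := by gcongr
    _ = _ := by ring
end

section
/- For every ε ∈ (0, 1/10) and all smooth functions W₁, W₂ : ℝ → ℝ with support contained in [1/2, 2], there exists C > 0 such that: for every integer q ≥ 2, all reals M₁, M₂, N₁, N₂ ≥ 1 with M₁M₂ ≤ q^{1−ε} and N₁N₂ ≤ q^{1+ε}, and all complex coefficients (α_{m₁}) for integers m₁ ∈ [M₁, 2M₁] and (β_{m₂}) for integers m₂ ∈ [M₂, 2M₂] satisfying |α_{m₁}| ≤ m₁^{ε} and |β_{m₂}| ≤ m₂^{ε}, one has |B(M₁,M₂,N₁,N₂)| ≤ C ( q^{ε} (M₁M₂N₁/(qN₂))^{1/2} + q^{−ε} ). -/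
open MeasureTheory

/-- `V(x) = (2π)^{-1} ∫_ℝ Γ(s_t/2+1/4)² Γ(1/4)^{-2} (πx)^{-s_t} s_t^{-1} dt`, `s_t = 2 + it`. -/
noncomputable def Vker (x : ℝ) : ℂ :=
  (1 / (2 * Real.pi)) *
    ∫ t : ℝ, (Complex.Gamma ((2 + Complex.I * t) / 2 + 1 / 4)) ^ 2 /
        (Complex.Gamma (1 / 4)) ^ 2 *
      (((Real.pi : ℂ) * x) ^ (-(2 + Complex.I * t))) / (2 + Complex.I * t)

/-- The bilinear sum `B(M₁,M₂,N₁,N₂)` of the paper. -/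
noncomputable def Bsum (q : ℕ) (M₁ M₂ N₁ N₂ : ℝ) (W₁ W₂ : ℝ → ℝ) (α β : ℕ → ℂ) : ℂ :=
  (((q : ℝ) ^ (-(3 : ℝ) / 2) * (M₁ * M₂ * N₁ * N₂) ^ (-(1 : ℝ) / 2) : ℝ) : ℂ) *
  ∑ q₁ ∈ q.divisors, (if Nat.Coprime q₁ (q / q₁) then
    ((ArithmeticFunction.moebius q₁ : ℤ) : ℂ) ^ 2 * (Nat.totient (q / q₁) : ℂ) *
    ∑ m₁ ∈ (Finset.Icc ⌈M₁⌉₊ ⌊2 * M₁⌋₊).filter (fun m => Nat.Coprime m q),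
    ∑ m₂ ∈ (Finset.Icc ⌈M₂⌉₊ ⌊2 * M₂⌋₊).filter (fun m => Nat.Coprime m q),
      α m₁ * β m₂ *
      ∑' n₁ : ℕ, ∑' n₂ : ℕ,
        (if 1 ≤ n₁ ∧ 1 ≤ n₂ ∧ Nat.Coprime n₁ q ∧ Nat.Coprime n₂ q ∧ 1 < m₁ * m₂ * n₁ then
          Vker ((n₁ * n₂ : ℝ) / q) * (W₁ ((n₁ : ℝ) / N₁) : ℂ) * (W₂ ((n₂ : ℝ) / N₂) : ℂ) *
            Complex.exp (2 * Real.pi * Complex.I *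
              ((((n₂ : ZMod (q / q₁)) *
                  ((n₁ * m₁ * m₂ * q₁ : ℕ) : ZMod (q / q₁))⁻¹).val : ℝ) / ((q / q₁ : ℕ) : ℝ)))
        else 0)
  else 0)

section

open Set

theorem integral_Ioo_cpow_sub_one {Y : ℝ} (hY : 0 < Y) {s : ℂ} (hs : 0 < s.re) :
    ∫ y in Ioo 0 Y, (y : ℂ) ^ (s - 1) = (Y : ℂ) ^ s / s := by
  have hs0 : s ≠ 0 := by rintro rfl; simp at hs
  rw [← integral_Ioc_eq_integral_Ioo, ← intervalIntegral.integral_of_le hY.le,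
    integral_cpow (Or.inl (by simpa using hs))]
  simp [hs0]

theorem integrableOn_Ioo_cpow_sub_one {Y : ℝ} (hY : 0 < Y) {s : ℂ} (hs : 0 < s.re) :
    IntegrableOn (fun y : ℝ => (y : ℂ) ^ (s - 1)) (Ioo 0 Y) := by
  refine IntegrableOn.mono_set ?_ Ioo_subset_Ioc_self
  rw [← intervalIntegrable_iff_integrableOn_Ioc_of_le hY.le]
  exact intervalIntegral.intervalIntegrable_cpow' (by simpa using hs)

theorem integral_Ioo_norm_cpow_sub_one {Y : ℝ} (hY : 0 < Y) {s : ℂ} (hs : 0 < s.re) :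
    ∫ y in Ioo 0 Y, ‖(y : ℂ) ^ (s - 1)‖ = Y ^ s.re / s.re := by
  have h : ∫ y in Ioo 0 Y, ‖(y : ℂ) ^ (s - 1)‖ = ∫ y in Ioo 0 Y, y ^ (s.re - 1) :=
    setIntegral_congr_fun measurableSet_Ioo fun y hy => by
      simp [Complex.norm_cpow_eq_rpow_re_of_pos hy.1]
  rw [h, ← integral_Ioc_eq_integral_Ioo, ← intervalIntegral.integral_of_le hY.le,
    integral_rpow (Or.inl (by linarith))]
  simp [ne_of_gt hs]

/-- The Mellin transform of the tail `y ↦ μ {Y > y}` is `s⁻¹ ∫ Y ^ s dμ`. -/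
theorem mellin_tail {Z : Type*} [MeasurableSpace Z] (μ : Measure Z) [IsFiniteMeasure μ]
    {Y : Z → ℝ} (hYm : Measurable Y) (hY : ∀ᵐ z ∂μ, 0 < Y z) {s : ℂ} (hs : 0 < s.re)
    (hint : Integrable (fun z => Y z ^ s.re) μ) :
    MellinConvergent (fun y => (μ.real {z | y < Y z} : ℂ)) s ∧
      mellin (fun y => (μ.real {z | y < Y z} : ℂ)) s = (∫ z, (Y z : ℂ) ^ s ∂μ) / s := by
  set F : ℝ × Z → ℂ := {p | p.1 < Y p.2}.indicator fun p => (p.1 : ℂ) ^ (s - 1) with hF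
  have hset : MeasurableSet {p : ℝ × Z | p.1 < Y p.2} :=
    measurableSet_lt measurable_fst (hYm.comp measurable_snd)
  have hFm : Measurable F :=
    ((Complex.measurable_ofReal.comp measurable_fst).pow_const _).indicator hset
  have hsec : ∀ z, (fun y => F (y, z)) = (Iio (Y z)).indicator fun y => (y : ℂ) ^ (s - 1) := by
    intro z; ext y; simp [hF, indicator]
  have hinter : ∀ z, Iio (Y z) ∩ Ioi 0 = Ioo 0 (Y z) := fun z => by
    ext y; simp [and_comm]
  have hFi : Integrable F ((volume.restrict (Ioi (0 : ℝ))).prod μ) := by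
    rw [integrable_prod_iff' hFm.aestronglyMeasurable]
    constructor
    · filter_upwards [hY] with z hz
      rw [hsec, integrable_indicator_iff measurableSet_Iio, IntegrableOn,
        Measure.restrict_restrict measurableSet_Iio, hinter]
      exact integrableOn_Ioo_cpow_sub_one hz hs
    · refine (hint.div_const s.re).congr ?_
      filter_upwards [hY] with z hz
      have : (fun y => ‖F (y, z)‖) = (Iio (Y z)).indicator fun y => ‖(y : ℂ) ^ (s - 1)‖ := by
        ext y; rw [← norm_indicator_eq_indicator_norm]; exact congrArg norm (congrFun (hsec z) y)
      rw [this, integral_indicator measurableSet_Iio, Measure.restrict_restrict measurableSet_Iio,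
        hinter, integral_Ioo_norm_cpow_sub_one hz hs]
  have hin : ∀ y, ∫ z, F (y, z) ∂μ = (y : ℂ) ^ (s - 1) • (μ.real {z | y < Y z} : ℂ) := by
    intro y
    have : (fun z => F (y, z)) = {z | y < Y z}.indicator fun _ => (y : ℂ) ^ (s - 1) := by
      ext z; simp [hF, indicator]
    rw [this, integral_indicator (measurableSet_lt measurable_const hYm)]
    simp [mul_comm, Measure.real]
  refine ⟨?_, ?_⟩
  · have := hFi.integral_prod_left
    simp_rw [hin] at this
    exact this
  · rw [mellin]
    simp_rw [← hin]
    rw [integral_integral_swap (f := fun y z => F (y, z)) hFi, ← integral_div]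
    refine integral_congr_ae ?_
    filter_upwards [hY] with z hz
    rw [hsec, integral_indicator measurableSet_Iio, Measure.restrict_restrict measurableSet_Iio,
        hinter, integral_Ioo_cpow_sub_one hz hs]

/-- The measure `exp (-u) u ^ (-3/4) du` on the positive half-line. -/
noncomputable def gammaWeight : Measure ℝ :=
  (volume.restrict (Ioi 0)).withDensity
    fun u => ENNReal.ofReal (Real.exp (-u) * u ^ (-(3 / 4) : ℝ))

theorem gammaWeight_integrand (s : ℂ) {u : ℝ} (hu : u ∈ Ioi (0 : ℝ)) :
    (ENNReal.ofReal (Real.exp (-u) * u ^ (-(3 / 4) : ℝ))).toReal • (u : ℂ) ^ s =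
      (Real.exp (-u) : ℂ) * (u : ℂ) ^ (s + 1 / 4 - 1) := by
  have hu' : (0 : ℝ) < u := hu
  rw [ENNReal.toReal_ofReal (by positivity), Complex.real_smul, Complex.ofReal_mul,
    Complex.ofReal_cpow hu'.le, mul_assoc, ← Complex.cpow_add _ _ (by exact_mod_cast hu'.ne')]
  congr 2
  push_cast
  ring

theorem integrable_cpow_gammaWeight {s : ℂ} (hs : -(1 / 4) < s.re) :
    Integrable (fun u : ℝ => (u : ℂ) ^ s) gammaWeight := by
  have hm : Measurable fun u : ℝ => ENNReal.ofReal (Real.exp (-u) * u ^ (-(3 / 4) : ℝ)) := by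
    fun_prop
  rw [gammaWeight, integrable_withDensity_iff_integrable_smul' hm (by simp)]
  have := Complex.GammaIntegral_convergent (s := s + 1 / 4) (by norm_num; linarith)
  exact this.congr_fun (fun u hu => (gammaWeight_integrand s hu).symm) measurableSet_Ioi

theorem integral_cpow_gammaWeight {s : ℂ} (hs : -(1 / 4) < s.re) :
    ∫ u : ℝ, (u : ℂ) ^ s ∂gammaWeight = Complex.Gamma (s + 1 / 4) := by
  have hm : Measurable fun u : ℝ => ENNReal.ofReal (Real.exp (-u) * u ^ (-(3 / 4) : ℝ)) := by
    fun_prop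
  rw [gammaWeight, integral_withDensity_eq_integral_toReal_smul hm (by simp),
    Complex.Gamma_eq_integral (by norm_num; linarith), Complex.GammaIntegral]
  exact setIntegral_congr_fun measurableSet_Ioi fun u hu => gammaWeight_integrand s hu

instance : IsFiniteMeasure gammaWeight := by
  have := integrable_cpow_gammaWeight (s := 0) (by norm_num)
  simpa [integrable_const_iff] using! this

theorem gammaWeight_pos : ∀ᵐ u ∂gammaWeight, 0 < u :=
  (withDensity_absolutelyContinuous _ _).ae_le (ae_restrict_mem measurableSet_Ioi)

instance : NullSingletonClass gammaWeight := by
  unfold gammaWeight; infer_instance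

theorem sqrt_mul_cpow {u v : ℝ} (hu : 0 < u) (hv : 0 < v) (s : ℂ) :
    (√(u * v) : ℂ) ^ s = (u : ℂ) ^ (s / 2) * (v : ℂ) ^ (s / 2) := by
  rw [Real.sqrt_eq_rpow, Real.mul_rpow hu.le hv.le, Complex.ofReal_mul,
    Complex.mul_cpow_ofReal_nonneg (by positivity) (by positivity)]
  have h : ∀ w : ℝ, 0 < w → ((w ^ (1 / 2 : ℝ) : ℝ) : ℂ) ^ s = (w : ℂ) ^ (s / 2) := by
    intro w hw
    have hw0 : (w : ℂ) ≠ 0 := by exact_mod_cast hw.ne'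
    rw [Complex.cpow_def_of_ne_zero (by exact_mod_cast (by positivity)),
      Complex.cpow_def_of_ne_zero hw0, ← Complex.ofReal_log (by positivity), Real.log_rpow hw,
      ← Complex.ofReal_log hw.le]
    congr 1
    push_cast
    ring
  rw [h u hu, h v hv]

/-- The mass that the square of `gammaWeight` gives to `{(u, v) | √(u v) > y}`. -/
noncomputable def gammaTail (y : ℝ) : ℝ :=
  (gammaWeight.prod gammaWeight).real {z : ℝ × ℝ | y < √(z.1 * z.2)}

theorem gammaWeight_prod_pos :
    ∀ᵐ z ∂gammaWeight.prod gammaWeight, (0 : ℝ) < z.1 ∧ (0 : ℝ) < z.2 := by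
  have h1 := Measure.quasiMeasurePreserving_fst (μ := gammaWeight) (ν := gammaWeight)
    |>.ae gammaWeight_pos
  have h2 := Measure.quasiMeasurePreserving_snd (μ := gammaWeight) (ν := gammaWeight)
    |>.ae gammaWeight_pos
  filter_upwards [h1, h2] with z h h' using ⟨h, h'⟩

theorem integrable_sqrt_cpow {s : ℂ} (hs : 0 < s.re) :
    Integrable (fun z : ℝ × ℝ => (√(z.1 * z.2) : ℂ) ^ s) (gammaWeight.prod gammaWeight) := by
  have hi := integrable_cpow_gammaWeight (s := s / 2) (by simp; linarith)
  refine (hi.mul_prod hi).congr ?_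
  filter_upwards [gammaWeight_prod_pos] with z hz using (sqrt_mul_cpow hz.1 hz.2 s).symm

theorem mellin_gammaTail {s : ℂ} (hs : 0 < s.re) :
    MellinConvergent (fun y => (gammaTail y : ℂ)) s ∧
      mellin (fun y => (gammaTail y : ℂ)) s = Complex.Gamma (s / 2 + 1 / 4) ^ 2 / s := by
  have hpos : ∀ᵐ z ∂gammaWeight.prod gammaWeight, (0 : ℝ) < √(z.1 * z.2) := by
    filter_upwards [gammaWeight_prod_pos] with z hz using Real.sqrt_pos.2 (mul_pos hz.1 hz.2)
  have hre : Integrable (fun z : ℝ × ℝ => √(z.1 * z.2) ^ s.re)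
      (gammaWeight.prod gammaWeight) := by
    refine (integrable_sqrt_cpow hs).norm.congr ?_
    filter_upwards [hpos] with z hz using Complex.norm_cpow_eq_rpow_re_of_pos hz s
  obtain ⟨h1, h2⟩ := mellin_tail (gammaWeight.prod gammaWeight)
    (Y := fun z : ℝ × ℝ => √(z.1 * z.2)) (by fun_prop) hpos hs hre
  refine ⟨h1, h2.trans ?_⟩
  congr 1
  rw [integral_congr_ae (g := fun z : ℝ × ℝ => (z.1 : ℂ) ^ (s / 2) * (z.2 : ℂ) ^ (s / 2)),
    integral_prod_mul (μ := gammaWeight) (ν := gammaWeight) (fun u : ℝ => (u : ℂ) ^ (s / 2))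
      (fun u : ℝ => (u : ℂ) ^ (s / 2)), integral_cpow_gammaWeight (by simp; linarith), sq]
  filter_upwards [gammaWeight_prod_pos] with z hz using sqrt_mul_cpow hz.1 hz.2 s

theorem ae_sqrt_ne {y : ℝ} (hy : 0 < y) :
    ∀ᵐ z ∂gammaWeight.prod gammaWeight, √(z.1 * z.2) ≠ y := by
  have hm : MeasurableSet {z : ℝ × ℝ | √(z.1 * z.2) = y} :=
    measurableSet_eq_fun (by fun_prop) measurable_const
  have : (gammaWeight.prod gammaWeight) {z : ℝ × ℝ | √(z.1 * z.2) = y} = 0 := by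
    rw [Measure.measure_prod_null hm]
    filter_upwards with u
    refine measure_mono_null (t := {y ^ 2 / u}) ?_ (measure_singleton _)
    intro v hv
    have hv' : √(u * v) = y := hv
    have h2 : u * v = y ^ 2 := by
      rw [← hv', Real.sq_sqrt]
      by_contra hneg
      rw [Real.sqrt_eq_zero_of_nonpos (not_le.1 hneg).le] at hv'
      exact hy.ne hv'
    have hu : u ≠ 0 := by
      rintro rfl
      have : 0 < y ^ 2 := by positivity
      simp at h2
      linarith
    simp only [mem_singleton_iff]
    field_simp
    linarith
  exact measure_eq_zero_iff_ae_notMem.1 this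

theorem continuousAt_gammaTail {y : ℝ} (hy : 0 < y) : ContinuousAt gammaTail y := by
  have hrep : gammaTail = fun x => ∫ z, {z : ℝ × ℝ | x < √(z.1 * z.2)}.indicator
      (fun _ => (1 : ℝ)) z ∂gammaWeight.prod gammaWeight := by
    ext x
    rw [integral_indicator_const _ (measurableSet_lt measurable_const (by fun_prop))]
    simp [gammaTail]
  rw [hrep]
  refine continuousAt_of_dominated (bound := fun _ => 1) ?_ ?_ (integrable_const _) ?_
  · filter_upwards with x
    exact (measurable_const.indicator
      (measurableSet_lt measurable_const (by fun_prop))).aestronglyMeasurable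
  · filter_upwards with x
    filter_upwards with z
    by_cases h : x < √(z.1 * z.2) <;> simp [indicator, h]
  · filter_upwards [ae_sqrt_ne hy] with z hz
    rcases lt_or_gt_of_ne hz with h | h
    · refine (continuousAt_const (y := (0 : ℝ))).congr ?_
      filter_upwards [lt_mem_nhds h] with x hx
      simp [indicator, hx.le]
    · refine (continuousAt_const (y := (1 : ℝ))).congr ?_
      filter_upwards [gt_mem_nhds h] with x hx
      simp [indicator, hx]

theorem antitone_gammaTail : Antitone gammaTail := fun x y hxy =>
  measureReal_mono fun _ hz => lt_of_le_of_lt hxy hz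

theorem gammaTail_nonneg (y : ℝ) : 0 ≤ gammaTail y := measureReal_nonneg

theorem norm_Gamma_le_Gamma_re {s : ℂ} (hs : 0 < s.re) :
    ‖Complex.Gamma s‖ ≤ Real.Gamma s.re := by
  rw [Complex.Gamma_eq_integral hs, Real.Gamma_eq_integral hs, Complex.GammaIntegral]
  refine (norm_integral_le_integral_norm _).trans_eq
    (setIntegral_congr_fun measurableSet_Ioi fun x hx => ?_)
  have hx' : (0 : ℝ) < x := hx
  simp [Complex.norm_cpow_eq_rpow_re_of_pos hx', Complex.norm_exp]

theorem norm_Gamma_sq_vertical_le (t : ℝ) :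
    ‖Complex.Gamma ((2 + t * Complex.I) / 2 + 1 / 4) ^ 2 / (2 + t * Complex.I)‖ ≤
      4 * Real.Gamma (9 / 4) ^ 2 * (1 + t ^ 2)⁻¹ := by
  set w : ℂ := (2 + t * Complex.I) / 2 + 1 / 4 with hw
  have hwre : w.re = 5 / 4 := by simp [hw]; norm_num
  have hwim : w.im = t / 2 := by simp [hw]
  have hw0 : w ≠ 0 := by intro h; rw [h] at hwre; norm_num at hwre
  have h1 : ‖Complex.Gamma (w + 1)‖ ≤ Real.Gamma (9 / 4) := by
    have := norm_Gamma_le_Gamma_re (s := w + 1) (by simp [hwre]; norm_num)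
    rwa [show (w + 1).re = 9 / 4 by simp [hwre]; norm_num] at this
  have h2 : Complex.Gamma w = Complex.Gamma (w + 1) / w := by
    rw [Complex.Gamma_add_one _ hw0]; field_simp
  have h3 : ‖w‖ ^ 2 = 25 / 16 + t ^ 2 / 4 := by
    rw [← Complex.normSq_eq_norm_sq, Complex.normSq_apply, hwre, hwim]; ring
  have h4 : 1 ≤ ‖(2 + t * Complex.I : ℂ)‖ := by
    refine le_trans ?_ (Complex.abs_re_le_norm _)
    simp
  rw [norm_div, norm_pow, h2, norm_div, div_pow, h3]
  have h5 : ‖Complex.Gamma (w + 1)‖ ^ 2 ≤ Real.Gamma (9 / 4) ^ 2 := by gcongr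
  calc _ ≤ ‖Complex.Gamma (w + 1)‖ ^ 2 / (25 / 16 + t ^ 2 / 4) / 1 := by gcongr
    _ ≤ Real.Gamma (9 / 4) ^ 2 / ((1 + t ^ 2) / 4) / 1 := by
      gcongr
      nlinarith
    _ = _ := by field_simp

theorem verticalIntegrable_mellin_gammaTail :
    Complex.VerticalIntegrable (mellin fun y => (gammaTail y : ℂ)) 2 := by
  have heq : ∀ t : ℝ, mellin (fun y => (gammaTail y : ℂ)) ((2 : ℝ) + t * Complex.I) =
      Complex.Gamma ((2 + t * Complex.I) / 2 + 1 / 4) ^ 2 / (2 + t * Complex.I) := by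
    intro t
    rw [(mellin_gammaTail (by simp)).2]
    simp
  rw [Complex.VerticalIntegrable]
  simp_rw [heq]
  refine (integrable_inv_one_add_sq.const_mul (4 * Real.Gamma (9 / 4) ^ 2)).mono' ?_
    (.of_forall norm_Gamma_sq_vertical_le)
  refine Continuous.aestronglyMeasurable ?_
  rw [continuous_iff_continuousAt]
  intro t
  have h2 : (2 + t * Complex.I : ℂ) ≠ 0 := by
    intro h; simpa using congrArg Complex.re h
  have hg : ContinuousAt Complex.Gamma ((2 + t * Complex.I) / 2 + 1 / 4) := by
    refine (Complex.differentiableAt_Gamma _ fun m h => ?_).continuousAt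
    have := congrArg Complex.re h
    simp at this
    have hm : (0 : ℝ) ≤ m := m.cast_nonneg
    linarith
  refine ContinuousAt.div (ContinuousAt.pow (ContinuousAt.comp' (f := fun t : ℝ =>
    ((2 + t * Complex.I) / 2 + 1 / 4 : ℂ)) hg ?_) 2) ?_ h2 <;> fun_prop

theorem Vker_eq {x : ℝ} (hx : 0 < x) :
    Vker x = ((gammaTail (Real.pi * x) / Real.Gamma (1 / 4) ^ 2 : ℝ) : ℂ) := by
  have hpx : 0 < Real.pi * x := by positivity
  have h := mellinInv_mellin_eq 2 (fun y => (gammaTail y : ℂ)) hpx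
    (mellin_gammaTail (by simp)).1 verticalIntegrable_mellin_gammaTail
    (Complex.continuous_ofReal.continuousAt.comp (continuousAt_gammaTail hpx))
  rw [Complex.ofReal_div, ← h, Vker, mellinInv, Complex.real_smul, mul_div_assoc, ← integral_div]
  congr 1
  · push_cast; ring
  refine integral_congr_ae (.of_forall fun t => ?_)
  have h2 : (mellin (fun y => (gammaTail y : ℂ)) ((2 : ℝ) + t * Complex.I)) =
      Complex.Gamma ((2 + t * Complex.I) / 2 + 1 / 4) ^ 2 / (2 + t * Complex.I) := by
    rw [(mellin_gammaTail (by simp)).2]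
    simp
  have hG : Complex.Gamma (1 / 4) = (Real.Gamma (1 / 4) : ℝ) := by
    rw [← Complex.Gamma_ofReal]; simp
  simp only [smul_eq_mul]
  rw [h2, hG]
  push_cast
  rw [mul_comm Complex.I]
  ring

theorem norm_sum_range_mul_le (z : ℂ) (hz : ‖z‖ = 1) (hz1 : z ≠ 1) (f : ℕ → ℝ) {M V : ℝ}
    (hM : ∀ n, |f n| ≤ M) (K : ℕ) (hV : ∑ n ∈ Finset.range K, |f (n + 1) - f n| ≤ V) :
    ‖∑ n ∈ Finset.range K, (f n : ℂ) * z ^ n‖ ≤ 2 / ‖z - 1‖ * (M + V) := by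
  have hz0 : 0 < ‖z - 1‖ := norm_pos_iff.2 (sub_ne_zero.2 hz1)
  have hgeom : ∀ n, ‖∑ i ∈ Finset.range n, z ^ i‖ ≤ 2 / ‖z - 1‖ := by
    intro n
    rw [geom_sum_eq hz1, norm_div]
    gcongr
    refine (norm_sub_le _ _).trans ?_
    simp [hz]
    norm_num
  have hd : 0 ≤ 2 / ‖z - 1‖ := by positivity
  have hparts := Finset.sum_range_by_parts (fun n => (f n : ℂ)) (fun n => z ^ n) K
  simp only [smul_eq_mul] at hparts
  rw [hparts]
  refine (norm_sub_le _ _).trans ?_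
  rw [mul_add]
  gcongr
  · rw [norm_mul, mul_comm, Complex.norm_real]
    gcongr
    · exact hgeom _
    · exact hM _
  · refine (norm_sum_le _ _).trans ?_
    calc _ ≤ ∑ n ∈ Finset.range (K - 1), 2 / ‖z - 1‖ * |f (n + 1) - f n| := by
          refine Finset.sum_le_sum fun n _ => ?_
          rw [norm_mul, mul_comm, ← Complex.ofReal_sub, Complex.norm_real]
          gcongr
          · exact hgeom _
          · rfl
      _ ≤ ∑ n ∈ Finset.range K, 2 / ‖z - 1‖ * |f (n + 1) - f n| :=
          Finset.sum_le_sum_of_subset_of_nonneg (by simp) fun _ _ _ => by positivity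
      _ = 2 / ‖z - 1‖ * ∑ n ∈ Finset.range K, |f (n + 1) - f n| := by rw [Finset.mul_sum]
      _ ≤ _ := by gcongr

theorem sum_abs_mul_sub_le {g w : ℕ → ℝ} {A B L : ℝ} (hg : Antitone g) (hg0 : ∀ n, 0 ≤ g n)
    (hgA : ∀ n, g n ≤ A) (hw : ∀ n, |w n| ≤ B) (hL : ∀ n, |w (n + 1) - w n| ≤ L) (K : ℕ) :
    ∑ n ∈ Finset.range K, |g (n + 1) * w (n + 1) - g n * w n| ≤ A * B + A * (K * L) := by
  have hB : 0 ≤ B := (abs_nonneg _).trans (hw 0)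
  have hL0 : 0 ≤ L := (abs_nonneg _).trans (hL 0)
  have h1 : ∀ n ∈ Finset.range K, |g (n + 1) * w (n + 1) - g n * w n| ≤
      B * (g n - g (n + 1)) + A * L := by
    intro n _
    have : g (n + 1) * w (n + 1) - g n * w n =
      (g (n + 1) - g n) * w (n + 1) + g n * (w (n + 1) - w n) := by ring
    rw [this]
    refine (abs_add_le _ _).trans ?_
    rw [abs_mul, abs_mul, abs_of_nonneg (hg0 n), abs_sub_comm,
      abs_of_nonneg (sub_nonneg.2 (hg n.le_succ)), mul_comm B]
    have h2 := sub_nonneg.2 (hg n.le_succ)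
    have := hw (n + 1)
    have := hL n
    have := hg0 n
    have := hgA n
    have hA : 0 ≤ A := (hg0 n).trans (hgA n)
    gcongr
  refine (Finset.sum_le_sum h1).trans ?_
  rw [Finset.sum_add_distrib, ← Finset.mul_sum, Finset.sum_range_sub']
  simp only [Finset.sum_const, Finset.card_range, nsmul_eq_mul]
  have : g 0 - g K ≤ A := by linarith [hgA 0, hg0 K]
  nlinarith

theorem norm_stdAddChar_sub_one {N : ℕ} [NeZero N] (x : ZMod N) :
    4 * |(x.valMinAbs : ℝ)| / N ≤ ‖ZMod.stdAddChar x - 1‖ := by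
  have hN : (0 : ℝ) < N := by exact_mod_cast Nat.pos_of_ne_zero (NeZero.ne N)
  set r := x.valMinAbs with hr
  have hx : x = (r : ZMod N) := (ZMod.coe_valMinAbs x).symm
  have habs : |(r : ℝ)| ≤ N / 2 := by
    have h := ZMod.natAbs_valMinAbs_le x
    rw [← hr] at h
    have h2 : 2 * r.natAbs ≤ N := by omega
    have h3 : (2 * (r.natAbs : ℝ)) ≤ N := by exact_mod_cast h2
    rw [Nat.cast_natAbs, Int.cast_abs] at h3
    linarith
  have he : ZMod.stdAddChar x = Complex.exp (Complex.I * ((2 * Real.pi * r / N : ℝ) : ℂ)) := by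
    rw [hx, ZMod.stdAddChar_coe]
    congr 1
    push_cast
    ring
  rw [he, Complex.norm_exp_I_mul_ofReal_sub_one, norm_mul, Real.norm_eq_abs, Real.norm_eq_abs,
    abs_two]
  have hs : |Real.sin (2 * Real.pi * r / N / 2)| = |Real.sin (Real.pi * |(r : ℝ)| / N)| := by
    rcases abs_choice (r : ℝ) with h | h <;> rw [h]
    · congr 2; ring
    · rw [← abs_neg, ← Real.sin_neg]; congr 2; ring
  rw [hs]
  have h1 := Real.mul_le_sin (x := Real.pi * |(r : ℝ)| / N) (by positivity) (by
    rw [div_le_div_iff₀ hN two_pos]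
    nlinarith [Real.pi_pos])
  have h2 : 2 / Real.pi * (Real.pi * |(r : ℝ)| / N) = 2 * |(r : ℝ)| / N := by
    field_simp
  rw [h2] at h1
  have h3 := le_abs_self (Real.sin (Real.pi * |(r : ℝ)| / N))
  calc 4 * |(r : ℝ)| / N = 2 * (2 * |(r : ℝ)| / N) := by ring
    _ ≤ _ := by linarith

/-- Removing a coprimality condition by Möbius inversion, in absolute values. -/
theorem norm_sum_coprime_le {q : ℕ} (hq : q ≠ 0) (F : ℕ → ℂ) (X : ℕ) :
    ‖∑ n ∈ (Finset.Icc 1 X).filter (fun n => Nat.Coprime n q), F n‖ ≤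
      ∑ d ∈ q.divisors, ‖∑ m ∈ Finset.Icc 1 (X / d), F (d * m)‖ := by
  have hmob : ∀ n, n ≠ 0 → (if Nat.Coprime n q then F n else 0) =
      ∑ d ∈ q.divisors, if d ∣ n then ((ArithmeticFunction.moebius d : ℤ) : ℂ) * F n else 0 := by
    intro n hn
    rw [← Finset.sum_filter]
    have hset : q.divisors.filter (· ∣ n) = (n.gcd q).divisors := by
      ext d
      simp [Nat.dvd_gcd_iff, hq, hn]
      tauto
    rw [hset, ← Finset.sum_mul, ← Int.cast_sum, ← ArithmeticFunction.coe_mul_zeta_apply,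
      ArithmeticFunction.moebius_mul_coe_zeta, ArithmeticFunction.one_apply]
    by_cases h : Nat.Coprime n q
    · rw [if_pos h, if_pos h]; simp
    · rw [if_neg h, if_neg h]; simp
  rw [Finset.sum_filter, Finset.sum_congr rfl fun n hn => hmob n (by simp at hn; omega),
    Finset.sum_comm]
  refine (norm_sum_le _ _).trans (Finset.sum_le_sum fun d hd => ?_)
  have hd0 : 0 < d := Nat.pos_of_mem_divisors hd
  have himg : (Finset.Icc 1 X).filter (d ∣ ·) = (Finset.Icc 1 (X / d)).image (d * ·) := by
    ext n
    simp only [Finset.mem_filter, Finset.mem_Icc, Finset.mem_image]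
    constructor
    · rintro ⟨⟨h1, h2⟩, m, rfl⟩
      exact ⟨m, ⟨Nat.pos_of_mul_pos_left h1, (Nat.le_div_iff_mul_le hd0).2 (by linarith)⟩, rfl⟩
    · rintro ⟨m, ⟨h1, h2⟩, rfl⟩
      have := (Nat.le_div_iff_mul_le hd0).1 h2
      exact ⟨⟨Nat.mul_pos hd0 h1, by linarith⟩, dvd_mul_right _ _⟩
  rw [← Finset.sum_filter, himg, Finset.sum_image fun a _ b _ h => Nat.eq_of_mul_eq_mul_left hd0 h,
    ← Finset.mul_sum, norm_mul]
  refine mul_le_of_le_one_left (norm_nonneg _) ?_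
  rw [Complex.norm_intCast]
  exact_mod_cast ArithmeticFunction.abs_moebius_le_one

/-- The divisor bound. -/
theorem exists_card_divisors_le {η : ℝ} (hη : 0 < η) :
    ∃ C : ℝ, 1 ≤ C ∧ ∀ n : ℕ, n ≠ 0 → (n.divisors.card : ℝ) ≤ C * (n : ℝ) ^ η := by
  set P : ℕ := ⌈(2 : ℝ) ^ η⁻¹⌉₊ with hP
  set K : ℝ := 1 + (η * Real.log 2)⁻¹ with hK
  have hl2 : 0 < Real.log 2 := Real.log_pos one_lt_two
  have hK1 : 1 ≤ K := by rw [hK]; have : 0 < (η * Real.log 2)⁻¹ := by positivity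
                         linarith
  have hloc : ∀ p e : ℕ, p.Prime →
      ((e + 1 : ℕ) : ℝ) ≤ (if p < P then K else 1) * ((p : ℝ) ^ η) ^ e := by
    intro p e hp
    have hp2 : (2 : ℝ) ≤ p := by exact_mod_cast hp.two_le
    split_ifs with h
    · have h1 : (2 : ℝ) ^ η ≤ (p : ℝ) ^ η := Real.rpow_le_rpow (by norm_num) hp2 hη.le
      have h2 : 1 + e * (η * Real.log 2) ≤ ((2 : ℝ) ^ η) ^ e := by
        rw [← Real.rpow_natCast, ← Real.rpow_mul (by norm_num), Real.rpow_def_of_pos two_pos]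
        have := Real.add_one_le_exp (Real.log 2 * (η * e))
        linarith
      have h3 : (e : ℝ) = (η * Real.log 2)⁻¹ * (e * (η * Real.log 2)) := by field_simp
      have hx : 0 ≤ (e : ℝ) * (η * Real.log 2) := by positivity
      have hy : 0 ≤ (η * Real.log 2)⁻¹ := by positivity
      calc ((e + 1 : ℕ) : ℝ) ≤ K * (1 + e * (η * Real.log 2)) := by
            push_cast
            nlinarith
        _ ≤ K * ((2 : ℝ) ^ η) ^ e := by gcongr
        _ ≤ _ := by gcongr
    · have h1 : (2 : ℝ) ≤ (p : ℝ) ^ η := by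
        have h4 : (2 : ℝ) ^ η⁻¹ ≤ p := (Nat.le_ceil _).trans (by exact_mod_cast not_lt.1 h)
        calc (2 : ℝ) = ((2 : ℝ) ^ η⁻¹) ^ η := by
              rw [← Real.rpow_mul (by norm_num), inv_mul_cancel₀ hη.ne', Real.rpow_one]
          _ ≤ _ := Real.rpow_le_rpow (by positivity) h4 hη.le
      rw [one_mul]
      calc ((e + 1 : ℕ) : ℝ) ≤ (2 : ℝ) ^ e := by exact_mod_cast (Nat.lt_two_pow_self (n := e))
        _ ≤ _ := by gcongr
  refine ⟨K ^ P, one_le_pow₀ hK1, fun n hn => ?_⟩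
  rw [Nat.card_divisors hn, Nat.cast_prod]
  calc ∏ p ∈ n.primeFactors, ((n.factorization p + 1 : ℕ) : ℝ)
      ≤ ∏ p ∈ n.primeFactors,
        (if p < P then K else 1) * ((p : ℝ) ^ η) ^ n.factorization p :=
        Finset.prod_le_prod (fun _ _ => by positivity) fun p hp =>
          hloc p _ (Nat.prime_of_mem_primeFactors hp)
    _ = (∏ p ∈ n.primeFactors, if p < P then K else 1) *
        ∏ p ∈ n.primeFactors, ((p : ℝ) ^ η) ^ n.factorization p := Finset.prod_mul_distrib
    _ ≤ K ^ P * (n : ℝ) ^ η := by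
      gcongr
      · rw [← Finset.prod_filter, Finset.prod_const]
        refine pow_le_pow_right₀ hK1 ?_
        calc _ ≤ (Finset.range P).card := Finset.card_le_card fun p hp => by
              simpa using (Finset.mem_filter.1 hp).2
          _ = P := Finset.card_range P
      · conv_rhs => rw [← Nat.prod_factorization_pow_eq_self hn]
        rw [Finsupp.prod, Nat.support_factorization, Nat.cast_prod,
          ← Real.finsetProd_rpow _ _ fun _ _ => by positivity]
        refine Finset.prod_le_prod (fun _ _ => by positivity) fun p _ => le_of_eq ?_
        rw [Nat.cast_pow, ← Real.rpow_natCast, ← Real.rpow_natCast, ← Real.rpow_mul (by positivity),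
          ← Real.rpow_mul (by positivity), mul_comm]

theorem valMinAbs_mul_inv_eq_zero {q₁ q₂ n d : ℕ} [NeZero q₂] (hn : Nat.Coprime (n * q₁) q₂)
    (h : ((d : ZMod q₂) * ((n * q₁ : ℕ) : ZMod q₂)⁻¹).valMinAbs = 0) : q₂ ∣ d := by
  rw [ZMod.valMinAbs_eq_zero] at h
  have h2 := ZMod.coe_mul_inv_eq_one _ hn
  rw [← ZMod.natCast_eq_zero_iff]
  calc (d : ZMod q₂) = d * (((n * q₁ : ℕ) : ZMod q₂) * ((n * q₁ : ℕ) : ZMod q₂)⁻¹) := by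
        rw [h2, mul_one]
    _ = (d * ((n * q₁ : ℕ) : ZMod q₂)⁻¹) * ((n * q₁ : ℕ) : ZMod q₂) := by ring
    _ = 0 := by rw [h, zero_mul]

theorem exists_valMinAbs_mul_inv {q₁ q₂ n d : ℕ} [NeZero q₂] (hq₁ : 0 < q₁)
    (hco : Nat.Coprime q₁ q₂) (hn : Nat.Coprime n (q₁ * q₂)) (hn1 : 1 < n) (hd : d ∣ q₁ * q₂)
    {r : ℤ} (hr : r = ((d : ZMod q₂) * ((n * q₁ : ℕ) : ZMod q₂)⁻¹).valMinAbs) (hr0 : r ≠ 0) :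
    ∃ k : ℤ, k ≠ 0 ∧ r * (q₁ * n) = d + k * q₂ ∧ |k| * q₂ ≤ 2 * |r| * (q₁ * n) ∧
      |k| ≤ q₁ * n := by
  have hq₂ : 0 < q₂ := Nat.pos_of_ne_zero (NeZero.ne q₂)
  have hcn : Nat.Coprime (n * q₁) q₂ :=
    Nat.Coprime.mul_left (hn.coprime_dvd_right (dvd_mul_left _ _)) hco
  have hmod : ((r * (q₁ * n) - d : ℤ) : ZMod q₂) = 0 := by
    have h2 := ZMod.coe_mul_inv_eq_one _ hcn
    have hrx : ((r : ℤ) : ZMod q₂) = (d : ZMod q₂) * ((n * q₁ : ℕ) : ZMod q₂)⁻¹ := by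
      rw [hr, ZMod.coe_valMinAbs]
    push_cast at h2 hrx ⊢
    rw [hrx]
    linear_combination (d : ZMod q₂) * h2
  obtain ⟨k, hk⟩ := (ZMod.intCast_zmod_eq_zero_iff_dvd _ _).1 hmod
  have heq : r * (q₁ * n) = d + k * q₂ := by linarith
  have hn0 : (0 : ℤ) < n := by exact_mod_cast (by omega : 0 < n)
  have hq₁' : (0 : ℤ) < q₁ := by exact_mod_cast hq₁
  have hq₂' : (0 : ℤ) < q₂ := by exact_mod_cast hq₂
  have hra : 0 < |r| := abs_pos.2 hr0
  have hk0 : k ≠ 0 := by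
    rintro rfl
    have h3 : (n : ℤ) ∣ d := ⟨r * q₁, by linarith⟩
    have h4 : n ∣ q₁ * q₂ := (Int.natCast_dvd_natCast.1 h3).trans hd
    have := Nat.Coprime.eq_one_of_dvd hn h4
    omega
  have hdr : (d : ℤ) ≤ |r| * (q₁ * n) := by
    have hg : ((d.gcd q₂ : ℕ) : ℤ) ∣ r := by
      have h5 : ((d.gcd q₂ : ℕ) : ℤ) ∣ r * ((n * q₁ : ℕ) : ℤ) := by
        have h6 : r * ((n * q₁ : ℕ) : ℤ) = d + k * q₂ := by push_cast; linarith
        rw [h6]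
        exact dvd_add (Int.natCast_dvd_natCast.2 (Nat.gcd_dvd_left _ _))
          (Dvd.dvd.mul_left (Int.natCast_dvd_natCast.2 (Nat.gcd_dvd_right _ _)) _)
      refine IsCoprime.dvd_of_dvd_mul_right ?_ h5
      exact Nat.isCoprime_iff_coprime.2 (hcn.coprime_dvd_right (Nat.gcd_dvd_right _ _)).symm
    have h7 : d ∣ q₁ * d.gcd q₂ := by
      rw [← Nat.gcd_mul_left]
      exact Nat.dvd_gcd (dvd_mul_left _ _) hd
    have h8 : (d : ℤ) ∣ q₁ * r :=
      (Int.natCast_dvd_natCast.2 h7).trans (by push_cast; exact mul_dvd_mul_left _ hg)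
    have h9 := Int.le_of_dvd (abs_pos.2 (mul_ne_zero hq₁'.ne' hr0)) ((dvd_abs _ _).2 h8)
    rw [abs_mul, abs_of_pos hq₁'] at h9
    nlinarith [mul_pos hq₁' hra]
  have hmain : |k| * q₂ ≤ 2 * |r| * (q₁ * n) := by
    have h1 : |k| * q₂ = |k * q₂| := by rw [abs_mul, abs_of_pos hq₂']
    have h2 : k * q₂ = r * (q₁ * n) - d := by linarith
    have h3 : |r * (q₁ * n)| = |r| * (q₁ * n) := by
      rw [abs_mul, abs_of_pos (mul_pos hq₁' hn0)]
    rw [h1, h2]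
    have := abs_sub (r * (q₁ * n)) d
    rw [h3, abs_of_nonneg (Int.natCast_nonneg d)] at this
    linarith
  refine ⟨k, hk0, heq, hmain, ?_⟩
  have hr2 : 2 * |r| ≤ q₂ := by
    have h := ZMod.natAbs_valMinAbs_le ((d : ZMod q₂) * ((n * q₁ : ℕ) : ZMod q₂)⁻¹)
    rw [← hr] at h
    rw [Int.abs_eq_natAbs]
    omega
  have hnq := mul_pos hq₁' hn0
  by_contra hlt
  push Not at hlt
  nlinarith

/-- Sum over one class `d ∣ n₂`. -/
theorem norm_sum_multiples_le {g W : ℝ → ℝ} {A B L : ℝ} (hg : Antitone g) (hg0 : ∀ x, 0 ≤ g x)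
    (hgA : ∀ x, g x ≤ A) (hW : ∀ x, |W x| ≤ B) (hL : ∀ x y, |W x - W y| ≤ L * |x - y|)
    {c N : ℝ} (hc : 0 ≤ c) (hN : 0 < N) {q₁ q₂ n d : ℕ} [NeZero q₂] (hq₁ : 0 < q₁)
    (hco : Nat.Coprime q₁ q₂) (hn : Nat.Coprime n (q₁ * q₂)) (hn1 : 1 < n) (hd : d ∣ q₁ * q₂) :
    let S := ‖∑ m ∈ Finset.Icc 1 (⌊2 * N⌋₊ / d),
      ((g (c * (d * m : ℕ)) * W ((d * m : ℕ) / N) : ℝ) : ℂ) *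
      ZMod.stdAddChar ((n * q₁ : ℕ) : ZMod q₂)⁻¹ ^ (d * m)‖
    S ≤ 2 * A * (B + L) * (N / q₂) ∨ ∃ k : ℤ, k ≠ 0 ∧ |k| ≤ q₁ * n ∧ (d : ℤ) + k * q₂ ≠ 0 ∧
      (n : ℤ) ∣ d + k * q₂ ∧ S ≤ 2 * A * (B + L) * (q₁ * n / |(k : ℝ)|) := by
  intro S
  have hq₂ : 0 < q₂ := Nat.pos_of_ne_zero (NeZero.ne q₂)
  have hd0 : 0 < d := Nat.pos_of_dvd_of_pos hd (Nat.mul_pos hq₁ hq₂)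
  have hd0' : (0 : ℝ) < d := by exact_mod_cast hd0
  have hA : 0 ≤ A := (hg0 0).trans (hgA 0)
  have hB : 0 ≤ B := (abs_nonneg _).trans (hW 0)
  have hL0 : 0 ≤ L := by simpa using (abs_nonneg _).trans (hL 1 0)
  have hq₂' : (0 : ℝ) < q₂ := by exact_mod_cast hq₂
  set x : ZMod q₂ := (d : ZMod q₂) * ((n * q₁ : ℕ) : ZMod q₂)⁻¹ with hx
  set K := ⌊2 * N⌋₊ / d with hK
  have hKN : (K : ℝ) * d ≤ 2 * N := by
    have : K * d ≤ ⌊2 * N⌋₊ := Nat.div_mul_le_self _ _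
    calc (K : ℝ) * d = ((K * d : ℕ) : ℝ) := by push_cast; ring
      _ ≤ (⌊2 * N⌋₊ : ℝ) := by exact_mod_cast this
      _ ≤ 2 * N := Nat.floor_le (by positivity)
  have hw1 : ∀ y : ZMod q₂, ‖ZMod.stdAddChar y‖ = 1 := fun y => by
    rw [ZMod.stdAddChar_apply]; exact Circle.norm_coe _
  by_cases hr0 : x.valMinAbs = 0
  · left
    have hdvd := valMinAbs_mul_inv_eq_zero
      (Nat.Coprime.mul_left (hn.coprime_dvd_right (dvd_mul_left _ _)) hco) hr0
    have hle : (q₂ : ℝ) ≤ d := by exact_mod_cast Nat.le_of_dvd hd0 hdvd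
    calc S ≤ ∑ m ∈ Finset.Icc 1 K, A * B := by
          refine (norm_sum_le _ _).trans (Finset.sum_le_sum fun m _ => ?_)
          rw [norm_mul, norm_pow, hw1, one_pow, mul_one, Complex.norm_real, norm_mul,
            Real.norm_eq_abs, Real.norm_eq_abs, abs_of_nonneg (hg0 _)]
          exact mul_le_mul (hgA _) (hW _) (abs_nonneg _) hA
      _ = A * B * K := by simp; ring
      _ ≤ A * (B + L) * (2 * N / q₂) := by
          gcongr
          · linarith
          · rw [le_div_iff₀ hq₂']
            exact (mul_le_mul_of_nonneg_left hle (by positivity)).trans hKN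
      _ = _ := by ring
  · right
    obtain ⟨k, hk0, heq, hk1, hk2⟩ := exists_valMinAbs_mul_inv hq₁ hco hn hn1 hd rfl hr0
    refine ⟨k, hk0, hk2, ?_, ⟨x.valMinAbs * q₁, ?_⟩, ?_⟩
    · rw [← heq]
      have : n ≠ 0 := by omega
      have := hq₁.ne'
      positivity
    · rw [← heq]; ring
    have hrpos : 0 < |(x.valMinAbs : ℝ)| := abs_pos.2 (by exact_mod_cast hr0)
    have hkpos : 0 < |(k : ℝ)| := abs_pos.2 (by exact_mod_cast hk0)
    set w := ZMod.stdAddChar x with hw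
    have hwd : ZMod.stdAddChar ((n * q₁ : ℕ) : ZMod q₂)⁻¹ ^ d = w := by
      rw [hw, hx, ← nsmul_eq_mul, AddChar.map_nsmul_eq_pow]
    have hlow := norm_stdAddChar_sub_one x
    have hlow0 : 0 < 4 * |(x.valMinAbs : ℝ)| / q₂ := by positivity
    have hw_ne : w ≠ 1 := by
      intro h
      rw [← hw, h, sub_self, norm_zero] at hlow
      linarith
    set f : ℕ → ℝ := fun i => g (c * (d * (i + 1) : ℕ)) * W ((d * (i + 1) : ℕ) / N) with hf
    have hS : S = ‖∑ i ∈ Finset.range K, (f i : ℂ) * w ^ i‖ := by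
      have : ∑ m ∈ Finset.Icc 1 K, ((g (c * (d * m : ℕ)) * W ((d * m : ℕ) / N) : ℝ) : ℂ) *
          ZMod.stdAddChar ((n * q₁ : ℕ) : ZMod q₂)⁻¹ ^ (d * m) =
          w * ∑ i ∈ Finset.range K, (f i : ℂ) * w ^ i := by
        rw [Finset.range_eq_Ico, Finset.mul_sum, ← Finset.Ico_add_one_right_eq_Icc,
          Finset.sum_Ico_eq_sum_range, ← Finset.range_eq_Ico]
        refine Finset.sum_congr (by simp) fun i _ => ?_
        rw [pow_mul, hwd, add_comm 1 i, pow_succ]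
        ring
      change ‖_‖ = _
      rw [this, norm_mul, hw1, one_mul]
    have hvar := sum_abs_mul_sub_le (g := fun i => g (c * (d * (i + 1) : ℕ)))
      (w := fun i => W ((d * (i + 1) : ℕ) / N)) (A := A) (B := B) (L := L * (d / N))
      (by
        intro i j hij
        apply hg
        gcongr) (fun _ => hg0 _) (fun _ => hgA _) (fun _ => hW _) (by
        intro i
        refine (hL _ _).trans_eq ?_
        congr 1
        rw [← sub_div]
        push_cast
        rw [show ((d : ℝ) * (i + 1 + 1) - d * (i + 1)) = d by ring,
          abs_of_pos (div_pos hd0' hN)]) K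
    have hb := norm_sum_range_mul_le w (hw1 _) hw_ne f (M := A * B) (fun i => by
      rw [hf]
      simp only [abs_mul, abs_of_nonneg (hg0 _)]
      exact mul_le_mul (hgA _) (hW _) (abs_nonneg _) hA) K hvar
    rw [hS]
    refine hb.trans ?_
    have hKL : A * (K * (L * (d / N))) ≤ A * (2 * L) := by
      refine mul_le_mul_of_nonneg_left ?_ hA
      calc (K : ℝ) * (L * (d / N)) = K * d / N * L := by ring
        _ ≤ 2 * L := by
          gcongr
          rw [div_le_iff₀ hN]
          exact hKN
    calc 2 / ‖w - 1‖ * (A * B + (A * B + A * (K * (L * (d / N)))))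
        ≤ 2 / (4 * |(x.valMinAbs : ℝ)| / q₂) * (2 * A * (B + L)) := by
          gcongr
          linarith
      _ = 2 * A * (B + L) * (q₂ / (2 * |(x.valMinAbs : ℝ)|)) := by field_simp; ring
      _ ≤ _ := by
          gcongr 2 * A * (B + L) * ?_
          rw [div_le_div_iff₀ (by positivity) hkpos]
          have : (|(k : ℝ)| * q₂) ≤ 2 * |(x.valMinAbs : ℝ)| * (q₁ * n) := by exact_mod_cast hk1
          linarith

/-- Sum over all `n₂` coprime to `q₁ q₂`. -/
theorem norm_sum_coprime_exp_le {g W : ℝ → ℝ} {A B L : ℝ} (hg : Antitone g) (hg0 : ∀ x, 0 ≤ g x)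
    (hgA : ∀ x, g x ≤ A) (hW : ∀ x, |W x| ≤ B) (hL : ∀ x y, |W x - W y| ≤ L * |x - y|)
    {c N : ℝ} (hc : 0 ≤ c) (hN : 0 < N) {q₁ q₂ n H : ℕ} [NeZero q₂] (hq₁ : 0 < q₁)
    (hco : Nat.Coprime q₁ q₂) (hn : Nat.Coprime n (q₁ * q₂)) (hn1 : 1 < n) (hH : q₁ * n ≤ H) :
    ‖∑ m ∈ (Finset.Icc 1 ⌊2 * N⌋₊).filter (fun m => Nat.Coprime m (q₁ * q₂)),
      ((g (c * m) * W (m / N) : ℝ) : ℂ) * ZMod.stdAddChar ((n * q₁ : ℕ) : ZMod q₂)⁻¹ ^ m‖ ≤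
    ∑ d ∈ (q₁ * q₂).divisors, (2 * A * (B + L) * (N / q₂) +
      ∑ j ∈ Finset.Icc 1 H, ∑ e ∈ ({1, -1} : Finset ℤ),
        if (d : ℤ) + e * j * q₂ ≠ 0 ∧ (n : ℤ) ∣ d + e * j * q₂ then
          2 * A * (B + L) * (q₁ * n / j) else 0) := by
  have hA : 0 ≤ A := (hg0 0).trans (hgA 0)
  have hB : 0 ≤ B := (abs_nonneg _).trans (hW 0)
  have hL0 : 0 ≤ L := by simpa using (abs_nonneg _).trans (hL 1 0)
  have hq : q₁ * q₂ ≠ 0 := mul_ne_zero hq₁.ne' (NeZero.ne q₂)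
  refine (norm_sum_coprime_le hq (fun m => ((g (c * m) * W (m / N) : ℝ) : ℂ) *
    ZMod.stdAddChar ((n * q₁ : ℕ) : ZMod q₂)⁻¹ ^ m) _).trans
    (Finset.sum_le_sum fun d hd => ?_)
  have hnn : ∀ j ∈ Finset.Icc 1 H, ∀ e ∈ ({1, -1} : Finset ℤ), (0 : ℝ) ≤
      if (d : ℤ) + e * j * q₂ ≠ 0 ∧ (n : ℤ) ∣ d + e * j * q₂ then
          2 * A * (B + L) * (q₁ * n / j) else 0 := by
    intro j _ e _
    split_ifs <;> positivity
  rcases norm_sum_multiples_le hg hg0 hgA hW hL hc hN hq₁ hco hn hn1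
    (Nat.dvd_of_mem_divisors hd) with h | ⟨k, hk0, hkH, hu0, hdvd, h⟩
  · exact h.trans (le_add_of_nonneg_right
      (Finset.sum_nonneg fun j hj => Finset.sum_nonneg fun e he => hnn j hj e he))
  · refine h.trans ((le_add_of_nonneg_left (by positivity)).trans' ?_)
    have hj : k.natAbs ∈ Finset.Icc 1 H := by
      rw [Finset.mem_Icc]
      have : (q₁ * n : ℤ) ≤ H := by exact_mod_cast hH
      rw [Int.abs_eq_natAbs] at hkH
      omega
    have he : k.sign ∈ ({1, -1} : Finset ℤ) := by
      rcases lt_or_gt_of_ne hk0 with h | h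
      · simp [Int.sign_eq_neg_one_of_neg h]
      · simp [Int.sign_eq_one_of_pos h]
    have hke : k.sign * (k.natAbs : ℤ) = k := Int.sign_mul_natAbs k
    refine le_trans ?_ (Finset.single_le_sum (fun j hj => Finset.sum_nonneg (hnn j hj)) hj)
    refine le_trans ?_ (Finset.single_le_sum (hnn _ hj) he)
    rw [hke, if_pos ⟨hu0, hdvd⟩, Nat.cast_natAbs, Int.cast_abs]

theorem card_filter_dvd_le (T : Finset (ℕ × ℕ × ℕ)) {u : ℤ} (hu : u ≠ 0) :
    (T.filter fun p => ((p.1 * p.2.1 * p.2.2 : ℕ) : ℤ) ∣ u).card ≤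
      u.natAbs.divisors.card ^ 3 := by
  rw [show ∀ a : ℕ, a ^ 3 = a * (a * a) by intro a; ring, ← Finset.card_product,
    ← Finset.card_product]
  refine Finset.card_le_card fun p hp => ?_
  have h := Int.natCast_dvd.1 (Finset.mem_filter.1 hp).2
  simp only [Finset.mem_product, Nat.mem_divisors]
  have hu' : u.natAbs ≠ 0 := by simpa using hu
  refine ⟨⟨(Dvd.intro _ (by rw [mul_assoc])).trans h, hu'⟩,
    ⟨(Dvd.intro_left (p.1 * p.2.2) (by ring)).trans h, hu'⟩,
    ⟨(dvd_mul_left _ _).trans h, hu'⟩⟩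

theorem sum_triples_le (T : Finset (ℕ × ℕ × ℕ)) {q₁ q₂ d H : ℕ} {Y t D : ℝ} (hD : 0 ≤ D)
    (hY : 0 ≤ Y) (ht0 : 0 ≤ t)
    (hT : ∀ p ∈ T, ((p.1 * p.2.1 * p.2.2 : ℕ) : ℝ) ≤ Y)
    (ht : ∀ m : ℕ, m ≠ 0 → m ≤ d + H * q₂ → (m.divisors.card : ℝ) ≤ t) :
    ∑ p ∈ T, ∑ j ∈ Finset.Icc 1 H, ∑ e ∈ ({1, -1} : Finset ℤ),
        (if (d : ℤ) + e * j * q₂ ≠ 0 ∧ ((p.1 * p.2.1 * p.2.2 : ℕ) : ℤ) ∣ d + e * j * q₂ then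
          D * (q₁ * (p.1 * p.2.1 * p.2.2 : ℕ) / j) else 0) ≤
      2 * D * q₁ * Y * t ^ 3 * (1 + Real.log H) := by
  rw [Finset.sum_comm]
  simp_rw [Finset.sum_comm (s := T)]
  have hterm : ∀ j ∈ Finset.Icc 1 H, ∀ e ∈ ({1, -1} : Finset ℤ),
      ∑ p ∈ T, (if (d : ℤ) + e * j * q₂ ≠ 0 ∧ ((p.1 * p.2.1 * p.2.2 : ℕ) : ℤ) ∣ d + e * j * q₂ then
          D * (q₁ * (p.1 * p.2.1 * p.2.2 : ℕ) / j) else 0) ≤ D * q₁ * Y * t ^ 3 * (j : ℝ)⁻¹ := by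
    intro j hj e he
    by_cases hu : (d : ℤ) + e * j * q₂ = 0
    · simp only [hu, ne_eq, not_true_eq_false, false_and, if_false, Finset.sum_const_zero]
      positivity
    simp only [hu, ne_eq, not_false_eq_true, true_and]
    rw [← Finset.sum_filter]
    have hcard := card_filter_dvd_le T hu
    have hsize : ((d : ℤ) + e * j * q₂).natAbs ≤ d + H * q₂ := by
      have hjH := (Finset.mem_Icc.1 hj).2
      have he1 : e.natAbs = 1 := by
        rcases Finset.mem_insert.1 he with rfl | he
        · rfl
        · rw [Finset.mem_singleton.1 he]; rfl
      refine (Int.natAbs_add_le _ _).trans ?_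
      rw [Int.natAbs_mul, Int.natAbs_mul, he1, one_mul, Int.natAbs_natCast, Int.natAbs_natCast,
        Int.natAbs_natCast]
      gcongr
    have htau := ht _ (by simpa using hu) hsize
    calc _ ≤ ∑ p ∈ T.filter (fun p => ((p.1 * p.2.1 * p.2.2 : ℕ) : ℤ) ∣ d + e * j * q₂),
          D * q₁ * Y * (j : ℝ)⁻¹ := by
          refine Finset.sum_le_sum fun p hp => ?_
          have := hT p (Finset.mem_filter.1 hp).1
          calc D * (q₁ * (p.1 * p.2.1 * p.2.2 : ℕ) / j) ≤ D * (q₁ * Y / j) := by gcongr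
            _ = _ := by ring
      _ = (T.filter (fun p => ((p.1 * p.2.1 * p.2.2 : ℕ) : ℤ) ∣ d + e * j * q₂)).card *
          (D * q₁ * Y * (j : ℝ)⁻¹) := by rw [Finset.sum_const, nsmul_eq_mul]
      _ ≤ t ^ 3 * (D * q₁ * Y * (j : ℝ)⁻¹) := by
          gcongr
          calc _ ≤ (((d : ℤ) + e * j * q₂).natAbs.divisors.card ^ 3 : ℝ) := by exact_mod_cast hcard
            _ ≤ t ^ 3 := by gcongr
      _ = _ := by ring
  refine (Finset.sum_le_sum fun j hj => Finset.sum_le_sum (hterm j hj)).trans ?_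
  have hharm : ∑ j ∈ Finset.Icc 1 H, (j : ℝ)⁻¹ ≤ 1 + Real.log H := by
    have := harmonic_le_one_add_log H
    rw [harmonic_eq_sum_Icc] at this
    push_cast at this
    exact this
  simp only [Finset.sum_const, nsmul_eq_mul]
  rw [show (({1, -1} : Finset ℤ).card : ℝ) = 2 by norm_num, ← Finset.mul_sum, ← Finset.mul_sum]
  calc _ ≤ 2 * (D * q₁ * Y * t ^ 3 * (1 + Real.log H)) := by gcongr
    _ = _ := by ring

theorem exp_val_div_eq_stdAddChar {N : ℕ} [NeZero N] (a : ℕ) (b : ZMod N) :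
    Complex.exp (2 * Real.pi * Complex.I * (((((a : ZMod N) * b).val : ℝ) / ((N : ℕ) : ℝ)))) =
      ZMod.stdAddChar b ^ a := by
  rw [← AddChar.map_nsmul_eq_pow, nsmul_eq_mul, ZMod.stdAddChar_apply, ZMod.toCircle_apply]
  congr 1
  push_cast
  ring

/-- The kernel `Vker (y / π)` extended monotonically to all real `y`. -/
noncomputable def normalizedTail (y : ℝ) : ℝ := gammaTail y / Real.Gamma (1 / 4) ^ 2

theorem antitone_normalizedTail : Antitone normalizedTail := fun _ _ h =>
  div_le_div_of_nonneg_right (antitone_gammaTail h) (sq_nonneg _)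

theorem normalizedTail_nonneg (y : ℝ) : 0 ≤ normalizedTail y :=
  div_nonneg (gammaTail_nonneg y) (sq_nonneg _)

theorem normalizedTail_le (y : ℝ) :
    normalizedTail y ≤ (gammaWeight.prod gammaWeight).real univ / Real.Gamma (1 / 4) ^ 2 :=
  div_le_div_of_nonneg_right (measureReal_mono (subset_univ _)) (sq_nonneg _)

theorem eq_zero_of_two_mul_floor_lt {W : ℝ → ℝ} (hW : Function.support W ⊆ Icc (1 / 2 : ℝ) 2)
    {N : ℝ} (hN : 1 ≤ N) {n : ℕ} (hn : n ∉ Finset.Icc 1 ⌊2 * N⌋₊) (hn1 : 1 ≤ n) :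
    W (n / N) = 0 := by
  by_contra h
  have h2 := (hW h).2
  rw [div_le_iff₀ (by linarith)] at h2
  exact hn (Finset.mem_Icc.2 ⟨hn1, Nat.le_floor h2⟩)

theorem tsum_tsum_eq {W₁ W₂ : ℝ → ℝ} (hW₁s : Function.support W₁ ⊆ Icc (1 / 2 : ℝ) 2)
    (hW₂s : Function.support W₂ ⊆ Icc (1 / 2 : ℝ) 2) {N₁ N₂ : ℝ} (hN₁ : 1 ≤ N₁) (hN₂ : 1 ≤ N₂)
    {q q₁ q₂ m₁ m₂ : ℕ} [NeZero q₂] (hq : q₁ * q₂ = q) (hq₁ : 0 < q₁) :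
    (∑' n₁ : ℕ, ∑' n₂ : ℕ,
      (if 1 ≤ n₁ ∧ 1 ≤ n₂ ∧ Nat.Coprime n₁ q ∧ Nat.Coprime n₂ q ∧ 1 < m₁ * m₂ * n₁ then
        Vker ((n₁ * n₂ : ℝ) / q) * (W₁ ((n₁ : ℝ) / N₁) : ℂ) * (W₂ ((n₂ : ℝ) / N₂) : ℂ) *
          Complex.exp (2 * Real.pi * Complex.I *
            ((((n₂ : ZMod q₂) * ((n₁ * m₁ * m₂ * q₁ : ℕ) : ZMod q₂)⁻¹).val : ℝ) /
              ((q₂ : ℕ) : ℝ)))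
      else 0)) =
    ∑ n₁ ∈ (Finset.Icc 1 ⌊2 * N₁⌋₊).filter (fun n => Nat.Coprime n q),
      if 1 < m₁ * m₂ * n₁ then (W₁ (n₁ / N₁) : ℂ) *
        ∑ n₂ ∈ (Finset.Icc 1 ⌊2 * N₂⌋₊).filter (fun n => Nat.Coprime n (q₁ * q₂)),
          ((normalizedTail (Real.pi * n₁ / q * n₂) * W₂ (n₂ / N₂) : ℝ) : ℂ) *
            ZMod.stdAddChar ((m₁ * m₂ * n₁ * q₁ : ℕ) : ZMod q₂)⁻¹ ^ n₂
      else 0 := by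
  have hq0 : (0 : ℝ) < q := by
    rw [← hq]; exact_mod_cast Nat.mul_pos hq₁ (Nat.pos_of_ne_zero (NeZero.ne q₂))
  rw [tsum_eq_sum (s := (Finset.Icc 1 ⌊2 * N₁⌋₊).filter (fun n => Nat.Coprime n q))]
  · refine Finset.sum_congr rfl fun n₁ hn₁ => ?_
    obtain ⟨hn₁', hco₁⟩ := Finset.mem_filter.1 hn₁
    have hn₁1 := (Finset.mem_Icc.1 hn₁').1
    rw [tsum_eq_sum (s := (Finset.Icc 1 ⌊2 * N₂⌋₊).filter (fun n => Nat.Coprime n (q₁ * q₂)))]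
    · by_cases h1 : 1 < m₁ * m₂ * n₁
      · rw [if_pos h1, Finset.mul_sum]
        refine Finset.sum_congr rfl fun n₂ hn₂ => ?_
        obtain ⟨hn₂', hco₂⟩ := Finset.mem_filter.1 hn₂
        have hn₂1 := (Finset.mem_Icc.1 hn₂').1
        rw [hq] at hco₂
        rw [if_pos ⟨hn₁1, hn₂1, hco₁, hco₂, h1⟩, exp_val_div_eq_stdAddChar,
          Vker_eq (by positivity),
          show n₁ * m₁ * m₂ * q₁ = m₁ * m₂ * n₁ * q₁ by ring,
          show Real.pi * ((n₁ : ℝ) * n₂ / q) = Real.pi * n₁ / q * n₂ by ring]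
        rw [normalizedTail]
        push_cast
        ring
      · rw [if_neg h1]
        exact Finset.sum_eq_zero fun n₂ _ => if_neg fun h => h1 h.2.2.2.2
    · intro n₂ hn₂
      split_ifs with h
      · rw [hq, Finset.mem_filter, not_and] at hn₂
        rw [eq_zero_of_two_mul_floor_lt hW₂s hN₂ (fun h' => hn₂ h' h.2.2.2.1) h.2.1]
        simp
      · rfl
  · intro n₁ hn₁
    refine (tsum_congr fun n₂ => ?_).trans tsum_zero
    split_ifs with h
    · rw [Finset.mem_filter, not_and] at hn₁
      rw [eq_zero_of_two_mul_floor_lt hW₁s hN₁ (fun h' => hn₁ h' h.2.2.1) h.1]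
      simp
    · rfl

theorem card_Icc_ceil_floor_le {M : ℝ} (hM : 1 ≤ M) :
    ((Finset.Icc ⌈M⌉₊ ⌊2 * M⌋₊).card : ℝ) ≤ 2 * M := by
  have h1 := Nat.le_ceil M
  have h2 := Nat.floor_le (show (0 : ℝ) ≤ 2 * M by linarith)
  rw [Nat.card_Icc]
  rcases le_total ⌈M⌉₊ (⌊2 * M⌋₊ + 1) with h | h
  · rw [Nat.cast_sub h]; push_cast; linarith
  · rw [Nat.sub_eq_zero_of_le h]; push_cast; linarith

/-- The contribution of one factorisation `q = q₁ q₂`. -/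
theorem totient_mul_norm_sum_le {W₁ W₂ : ℝ → ℝ} {A B₁ B₂ L : ℝ}
    (hA : ∀ x, normalizedTail x ≤ A)
    (hB₁ : ∀ x, |W₁ x| ≤ B₁) (hB₂ : ∀ x, |W₂ x| ≤ B₂)
    (hL : ∀ x y, |W₂ x - W₂ y| ≤ L * |x - y|)
    (hW₁s : Function.support W₁ ⊆ Icc (1 / 2 : ℝ) 2)
    (hW₂s : Function.support W₂ ⊆ Icc (1 / 2 : ℝ) 2) {M₁ M₂ N₁ N₂ : ℝ} (hM₁ : 1 ≤ M₁)
    (hM₂ : 1 ≤ M₂) (hN₁ : 1 ≤ N₁) (hN₂ : 1 ≤ N₂)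
    {q q₁ q₂ H : ℕ} [NeZero q₂] (hq : q₁ * q₂ = q) (hq₁ : 0 < q₁) (hco : Nat.Coprime q₁ q₂)
    {t R : ℝ} (hH : q * (8 * (M₁ * M₂ * N₁)) ≤ H)
    (ht : ∀ m : ℕ, m ≠ 0 → m ≤ q + H * q → (m.divisors.card : ℝ) ≤ t)
    {α β : ℕ → ℂ}
    (hαβ : ∀ m₁ ∈ Finset.Icc ⌈M₁⌉₊ ⌊2 * M₁⌋₊, ∀ m₂ ∈ Finset.Icc ⌈M₂⌉₊ ⌊2 * M₂⌋₊,
      ‖α m₁ * β m₂‖ ≤ R) :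
    (q₂ : ℝ) * ‖∑ m₁ ∈ (Finset.Icc ⌈M₁⌉₊ ⌊2 * M₁⌋₊).filter (fun m => Nat.Coprime m q),
      ∑ m₂ ∈ (Finset.Icc ⌈M₂⌉₊ ⌊2 * M₂⌋₊).filter (fun m => Nat.Coprime m q),
      α m₁ * β m₂ * (∑' n₁ : ℕ, ∑' n₂ : ℕ,
      (if 1 ≤ n₁ ∧ 1 ≤ n₂ ∧ Nat.Coprime n₁ q ∧ Nat.Coprime n₂ q ∧ 1 < m₁ * m₂ * n₁ then
        Vker ((n₁ * n₂ : ℝ) / q) * (W₁ ((n₁ : ℝ) / N₁) : ℂ) * (W₂ ((n₂ : ℝ) / N₂) : ℂ) *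
          Complex.exp (2 * Real.pi * Complex.I *
            ((((n₂ : ZMod q₂) * ((n₁ * m₁ * m₂ * q₁ : ℕ) : ZMod q₂)⁻¹).val : ℝ) /
              ((q₂ : ℕ) : ℝ)))
      else 0))‖ ≤
    q.divisors.card * (R * B₁ * (2 * A * (B₂ + L)) * (8 * (M₁ * M₂ * N₁))) *
      (N₂ + q * (2 * t ^ 3 * (1 + Real.log H))) := by
  have hA0 : 0 ≤ A := (normalizedTail_nonneg 0).trans (hA 0)
  have hB₁0 : 0 ≤ B₁ := (abs_nonneg _).trans (hB₁ 0)
  have hB₂0 : 0 ≤ B₂ := (abs_nonneg _).trans (hB₂ 0)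
  have hL0 : 0 ≤ L := by simpa using (abs_nonneg _).trans (hL 1 0)
  have hq₂ : 0 < q₂ := Nat.pos_of_ne_zero (NeZero.ne q₂)
  have hq0 : 0 < q := hq ▸ Nat.mul_pos hq₁ hq₂
  set D : ℝ := 2 * A * (B₂ + L) with hD
  have hD0 : 0 ≤ D := by positivity
  set Y : ℝ := 8 * (M₁ * M₂ * N₁) with hY
  have hY0 : 0 ≤ Y := by positivity
  have ht0 : 0 ≤ t := by
    have := ht 1 one_ne_zero (by omega)
    exact (Nat.cast_nonneg _).trans this
  set S₁ := Finset.Icc ⌈M₁⌉₊ ⌊2 * M₁⌋₊ with hS₁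
  set S₂ := Finset.Icc ⌈M₂⌉₊ ⌊2 * M₂⌋₊ with hS₂
  set S₃ := Finset.Icc 1 ⌊2 * N₁⌋₊ with hS₃
  have hR0 : S₁.Nonempty → S₂.Nonempty → 0 ≤ R := fun ⟨a, ha⟩ ⟨b, hb⟩ =>
    (norm_nonneg _).trans (hαβ a ha b hb)
  have hS₁ne : S₁.Nonempty := by
    rw [Finset.nonempty_Icc]
    refine Nat.le_floor ((Nat.ceil_lt_add_one (by linarith)).le.trans (by linarith))
  have hS₂ne : S₂.Nonempty := by
    rw [Finset.nonempty_Icc]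
    refine Nat.le_floor ((Nat.ceil_lt_add_one (by linarith)).le.trans (by linarith))
  have hR : 0 ≤ R := hR0 hS₁ne hS₂ne
  set E : ℕ × ℕ × ℕ → ℝ := fun p => ∑ d ∈ q.divisors, (D * (N₂ / q₂) +
      ∑ j ∈ Finset.Icc 1 H, ∑ e ∈ ({1, -1} : Finset ℤ),
        if (d : ℤ) + e * j * q₂ ≠ 0 ∧ ((p.1 * p.2.1 * p.2.2 : ℕ) : ℤ) ∣ d + e * j * q₂ then
          D * (q₁ * (p.1 * p.2.1 * p.2.2 : ℕ) / j) else 0) with hE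
  set T := ((S₁.filter (fun m => Nat.Coprime m q)) ×ˢ (S₂.filter (fun m => Nat.Coprime m q)) ×ˢ
    (S₃.filter (fun m => Nat.Coprime m q))).filter (fun p => 1 < p.1 * p.2.1 * p.2.2) with hT
  have hsize : ∀ m₁ ∈ S₁, ∀ m₂ ∈ S₂, ∀ n₁ ∈ S₃, ((m₁ * m₂ * n₁ : ℕ) : ℝ) ≤ Y := by
    intro m₁ h₁ m₂ h₂ n₁ h₃
    have e : ∀ (X : ℝ) (a : ℕ), 1 ≤ X → a ≤ ⌊2 * X⌋₊ → (a : ℝ) ≤ 2 * X := fun X a hX ha =>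
      (Nat.cast_le.2 ha).trans (Nat.floor_le (by linarith))
    have a₁ := e _ _ hM₁ (Finset.mem_Icc.1 h₁).2
    have a₂ := e _ _ hM₂ (Finset.mem_Icc.1 h₂).2
    have a₃ := e _ _ hN₁ (Finset.mem_Icc.1 h₃).2
    push_cast
    calc (m₁ * m₂ * n₁ : ℝ) ≤ (2 * M₁) * (2 * M₂) * (2 * N₁) := by gcongr
      _ = Y := by rw [hY]; ring
  have hcard : (T.card : ℝ) ≤ Y := by
    calc (T.card : ℝ) ≤ ((S₁.card * (S₂.card * S₃.card) : ℕ) : ℝ) := by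
          rw [← Finset.card_product, ← Finset.card_product]
          refine Nat.cast_le.2 (Finset.card_le_card ((Finset.filter_subset _ _).trans ?_))
          exact Finset.product_subset_product (Finset.filter_subset _ _)
            (Finset.product_subset_product (Finset.filter_subset _ _) (Finset.filter_subset _ _))
      _ ≤ (2 * M₁) * ((2 * M₂) * (2 * N₁)) := by
          push_cast
          have h3 : (S₃.card : ℝ) ≤ 2 * N₁ := by
            rw [hS₃, Nat.card_Icc, Nat.add_sub_cancel]
            exact Nat.floor_le (by linarith)
          have h1 := card_Icc_ceil_floor_le hM₁
          have h2 := card_Icc_ceil_floor_le hM₂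
          gcongr
      _ = Y := by rw [hY]; ring
  have hEsum : ∑ p ∈ T, E p ≤
      q.divisors.card * (Y * (D * (N₂ / q₂)) + 2 * D * q₁ * Y * t ^ 3 * (1 + Real.log H)) := by
    rw [hE, Finset.sum_comm, ← nsmul_eq_mul]
    refine Finset.sum_le_card_nsmul _ _ _ fun d hd => ?_
    rw [Finset.sum_add_distrib, Finset.sum_const, nsmul_eq_mul]
    refine add_le_add (mul_le_mul_of_nonneg_right hcard (by positivity)) ?_
    refine sum_triples_le T hD0 hY0 ht0 (fun p hp => ?_) fun m hm0 hm => ht m hm0 (hm.trans ?_)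
    · simp only [hT, Finset.mem_filter, Finset.mem_product] at hp
      exact hsize _ hp.1.1.1 _ hp.1.2.1.1 _ hp.1.2.2.1
    · have h1 := Nat.divisor_le hd
      have h2 : q₂ ≤ q := hq ▸ Nat.le_mul_of_pos_left _ hq₁
      gcongr
  have hinner : ∀ m₁ ∈ S₁.filter (fun m => Nat.Coprime m q),
      ∀ m₂ ∈ S₂.filter (fun m => Nat.Coprime m q),
      ∀ n₁ ∈ S₃.filter (fun m => Nat.Coprime m q), 1 < m₁ * m₂ * n₁ →
      ‖(W₁ (n₁ / N₁) : ℂ) *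
        ∑ n₂ ∈ (Finset.Icc 1 ⌊2 * N₂⌋₊).filter (fun n => Nat.Coprime n (q₁ * q₂)),
          ((normalizedTail (Real.pi * n₁ / q * n₂) * W₂ (n₂ / N₂) : ℝ) : ℂ) *
            ZMod.stdAddChar ((m₁ * m₂ * n₁ * q₁ : ℕ) : ZMod q₂)⁻¹ ^ n₂‖ ≤
        B₁ * E (m₁, m₂, n₁) := by
    intro m₁ h₁ m₂ h₂ n₁ h₃ h1
    rw [norm_mul, Complex.norm_real]
    refine mul_le_mul (hB₁ _) ?_ (norm_nonneg _) hB₁0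
    have := norm_sum_coprime_exp_le (H := H) antitone_normalizedTail normalizedTail_nonneg hA
      hB₂ hL (c := Real.pi * n₁ / q) (N := N₂) (by positivity) (by linarith) hq₁ hco
      (n := m₁ * m₂ * n₁) (by
        rw [hq]
        exact ((Finset.mem_filter.1 h₁).2.mul_left (Finset.mem_filter.1 h₂).2).mul_left
          (Finset.mem_filter.1 h₃).2) h1 (by
        have h4 := hsize _ (Finset.mem_filter.1 h₁).1 _ (Finset.mem_filter.1 h₂).1 _
          (Finset.mem_filter.1 h₃).1
        have h5 : (q₁ : ℝ) ≤ q := by exact_mod_cast hq ▸ Nat.le_mul_of_pos_right _ hq₂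
        have h6 : (q₁ : ℝ) * ((m₁ * m₂ * n₁ : ℕ) : ℝ) ≤ H :=
          (mul_le_mul h5 h4 (by positivity) (by positivity)).trans hH
        exact_mod_cast h6)
    rw [hq] at this
    rw [hq]
    exact this
  have hsum : ‖∑ m₁ ∈ S₁.filter (fun m => Nat.Coprime m q),
      ∑ m₂ ∈ S₂.filter (fun m => Nat.Coprime m q), α m₁ * β m₂ * (∑' n₁ : ℕ, ∑' n₂ : ℕ,
      (if 1 ≤ n₁ ∧ 1 ≤ n₂ ∧ Nat.Coprime n₁ q ∧ Nat.Coprime n₂ q ∧ 1 < m₁ * m₂ * n₁ then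
        Vker ((n₁ * n₂ : ℝ) / q) * (W₁ ((n₁ : ℝ) / N₁) : ℂ) * (W₂ ((n₂ : ℝ) / N₂) : ℂ) *
          Complex.exp (2 * Real.pi * Complex.I *
            ((((n₂ : ZMod q₂) * ((n₁ * m₁ * m₂ * q₁ : ℕ) : ZMod q₂)⁻¹).val : ℝ) /
              ((q₂ : ℕ) : ℝ)))
      else 0))‖ ≤ R * B₁ * ∑ p ∈ T, E p := by
    have hTE : ∑ p ∈ T, E p = ∑ m₁ ∈ S₁.filter (fun m => Nat.Coprime m q),
        ∑ m₂ ∈ S₂.filter (fun m => Nat.Coprime m q),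
        ∑ n₁ ∈ S₃.filter (fun m => Nat.Coprime m q),
          if 1 < m₁ * m₂ * n₁ then E (m₁, m₂, n₁) else 0 := by
      rw [hT, Finset.sum_filter, Finset.sum_product]
      exact Finset.sum_congr rfl fun m₁ _ => Finset.sum_product _ _ _
    rw [hTE, Finset.mul_sum]
    refine (norm_sum_le _ _).trans (Finset.sum_le_sum fun m₁ h₁ => ?_)
    rw [Finset.mul_sum]
    refine (norm_sum_le _ _).trans (Finset.sum_le_sum fun m₂ h₂ => ?_)
    rw [norm_mul, mul_assoc R]
    refine mul_le_mul (hαβ _ (Finset.mem_filter.1 h₁).1 _ (Finset.mem_filter.1 h₂).1) ?_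
      (norm_nonneg _) hR
    rw [tsum_tsum_eq hW₁s hW₂s hN₁ hN₂ hq hq₁, Finset.mul_sum]
    refine (norm_sum_le _ _).trans (Finset.sum_le_sum fun n₁ h₃ => ?_)
    split_ifs with h
    · exact hinner _ h₁ _ h₂ _ h₃ h
    · simp
  have hq₂' : (0 : ℝ) < q₂ := by exact_mod_cast hq₂
  calc _ ≤ (q₂ : ℝ) * (R * B₁ * (q.divisors.card *
        (Y * (D * (N₂ / q₂)) + 2 * D * q₁ * Y * t ^ 3 * (1 + Real.log H)))) := by
        gcongr
        exact hsum.trans (by gcongr)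
    _ = _ := by
        rw [← hq]
        push_cast
        field_simp

theorem rpow_mul_normalization_le {Q P N ε : ℝ} (hQ : 1 ≤ Q) (hP : 0 < P) (hN : 0 < N)
    (hPN : P * N ≤ Q ^ 2) (hε : ε ≤ 1 / 4) :
    Q ^ ε * (Q ^ (-(3 : ℝ) / 2) * (P * N) ^ (-(1 : ℝ) / 2) * (P * (N + Q))) ≤
      Q ^ ε * (P / (Q * N)) ^ ((1 : ℝ) / 2) + Q ^ (-ε) := by
  have hQ0 : 0 < Q := by linarith
  have hlow : Q ^ (-(3 : ℝ) / 2) * (P * N) ^ (-(1 : ℝ) / 2) * (P * N) ≤ Q ^ (-(1 : ℝ) / 2) := by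
    have h1 : (P * N) ^ (-(1 : ℝ) / 2) * (P * N) = (P * N) ^ ((1 : ℝ) / 2) := by
      rw [← Real.rpow_add_one (by positivity)]; norm_num
    rw [mul_assoc, h1]
    calc _ ≤ Q ^ (-(3 : ℝ) / 2) * (Q ^ 2) ^ ((1 : ℝ) / 2) := by gcongr
      _ = Q ^ (-(1 : ℝ) / 2) := by
        rw [← Real.rpow_natCast, ← Real.rpow_mul hQ0.le, ← Real.rpow_add hQ0]; norm_num
  have hmain : Q ^ (-(3 : ℝ) / 2) * (P * N) ^ (-(1 : ℝ) / 2) * (P * Q) =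
      (P / (Q * N)) ^ ((1 : ℝ) / 2) := by
    rw [Real.div_rpow hP.le (by positivity), Real.mul_rpow hP.le hN.le,
      Real.mul_rpow hQ0.le hN.le, div_eq_mul_inv (P ^ _), mul_inv, ← Real.rpow_neg hQ0.le,
      ← Real.rpow_neg hN.le]
    calc _ = (Q ^ (-(3 : ℝ) / 2) * Q) * (P ^ (-(1 : ℝ) / 2) * P) * N ^ (-(1 : ℝ) / 2) := by ring
      _ = _ := by
        rw [← Real.rpow_add_one hQ0.ne', ← Real.rpow_add_one hP.ne']
        norm_num
        ring
  calc _ = Q ^ ε * (Q ^ (-(3 : ℝ) / 2) * (P * N) ^ (-(1 : ℝ) / 2) * (P * Q)) +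
        Q ^ ε * (Q ^ (-(3 : ℝ) / 2) * (P * N) ^ (-(1 : ℝ) / 2) * (P * N)) := by ring
    _ ≤ Q ^ ε * (P / (Q * N)) ^ ((1 : ℝ) / 2) + Q ^ ε * Q ^ (-(1 : ℝ) / 2) := by
        rw [hmain]; gcongr
    _ ≤ _ := by
        gcongr
        rw [← Real.rpow_add hQ0]
        exact Real.rpow_le_rpow_of_exponent_le hQ (by linarith)

theorem two_mul_cube_mul_one_add_log_le {Q H t c η : ℝ} (hQ : 1 ≤ Q) (hη : 0 < η) (hη1 : η ≤ 1)
    (hc : 0 ≤ c) (ht : t = c * (10 * Q ^ 4) ^ η) (hH : 0 ≤ H) (hHQ : H ≤ 9 * Q ^ 3) :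
    2 * t ^ 3 * (1 + Real.log H) ≤ 18000 * c ^ 3 * (1 + 1 / η) * Q ^ (15 * η) := by
  have hQ0 : 0 < Q := by linarith
  have hpow : ∀ (a : ℝ) (k : ℕ), 1 ≤ a → (a * Q ^ k) ^ η ≤ a * Q ^ (k * η) := fun a k ha => by
    rw [Real.mul_rpow (by linarith) (by positivity), ← Real.rpow_natCast, ← Real.rpow_mul hQ0.le]
    gcongr
    exact (Real.rpow_le_rpow_of_exponent_le ha hη1).trans (Real.rpow_one a).le
  have ht0 : 0 ≤ t := by rw [ht]; positivity
  have ht' : t ≤ c * (10 * Q ^ (4 * η)) := by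
    rw [ht]
    gcongr
    exact_mod_cast hpow 10 4 (by norm_num)
  have hlog : 1 + Real.log H ≤ (1 + 1 / η) * (9 * Q ^ (3 * η)) := by
    have h1 : (9 * Q ^ 3) ^ η ≤ 9 * Q ^ (3 * η) := by exact_mod_cast hpow 9 3 (by norm_num)
    have h2 : Real.log H ≤ (9 * Q ^ (3 * η)) / η :=
      (Real.log_le_rpow_div hH hη).trans (by gcongr; exact (by gcongr : H ^ η ≤ _).trans h1)
    have h3 : 1 ≤ 9 * Q ^ (3 * η) := by
      have := Real.one_le_rpow hQ (show 0 ≤ 3 * η by positivity)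
      linarith
    calc _ ≤ 9 * Q ^ (3 * η) + 9 * Q ^ (3 * η) / η := add_le_add h3 h2
      _ = _ := by ring
  calc _ ≤ 2 * t ^ 3 * ((1 + 1 / η) * (9 * Q ^ (3 * η))) := by gcongr
    _ ≤ 2 * (c * (10 * Q ^ (4 * η))) ^ 3 * ((1 + 1 / η) * (9 * Q ^ (3 * η))) := by gcongr
    _ = 18000 * c ^ 3 * (1 + 1 / η) * ((Q ^ (4 * η)) ^ 3 * Q ^ (3 * η)) := by ring
    _ = _ := by
      rw [← Real.rpow_natCast (Q ^ _), ← Real.rpow_mul hQ0.le, ← Real.rpow_add hQ0]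
      congr 2
      push_cast
      ring

/-- Summing the contributions of all coprime factorisations `q = q₁ q₂`. -/
theorem norm_Bsum_le {q : ℕ} {M₁ M₂ N₁ N₂ X : ℝ} {W₁ W₂ : ℝ → ℝ} {α β : ℕ → ℂ}
    (hM₁ : 1 ≤ M₁) (hM₂ : 1 ≤ M₂) (hN₁ : 1 ≤ N₁) (hN₂ : 1 ≤ N₂) (hX : 0 ≤ X)
    (h : ∀ q₁ ∈ q.divisors, Nat.Coprime q₁ (q / q₁) → ((q / q₁ : ℕ) : ℝ) *
      ‖∑ m₁ ∈ (Finset.Icc ⌈M₁⌉₊ ⌊2 * M₁⌋₊).filter (fun m => Nat.Coprime m q),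
      ∑ m₂ ∈ (Finset.Icc ⌈M₂⌉₊ ⌊2 * M₂⌋₊).filter (fun m => Nat.Coprime m q),
      α m₁ * β m₂ *
      ∑' n₁ : ℕ, ∑' n₂ : ℕ,
        (if 1 ≤ n₁ ∧ 1 ≤ n₂ ∧ Nat.Coprime n₁ q ∧ Nat.Coprime n₂ q ∧ 1 < m₁ * m₂ * n₁ then
          Vker ((n₁ * n₂ : ℝ) / q) * (W₁ ((n₁ : ℝ) / N₁) : ℂ) * (W₂ ((n₂ : ℝ) / N₂) : ℂ) *
            Complex.exp (2 * Real.pi * Complex.I *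
              ((((n₂ : ZMod (q / q₁)) *
                  ((n₁ * m₁ * m₂ * q₁ : ℕ) : ZMod (q / q₁))⁻¹).val : ℝ) / ((q / q₁ : ℕ) : ℝ)))
        else 0)‖ ≤ X) :
    ‖Bsum q M₁ M₂ N₁ N₂ W₁ W₂ α β‖ ≤
      (q : ℝ) ^ (-(3 : ℝ) / 2) * (M₁ * M₂ * N₁ * N₂) ^ (-(1 : ℝ) / 2) *
        (q.divisors.card * X) := by
  have h0 : 0 ≤ (q : ℝ) ^ (-(3 : ℝ) / 2) * (M₁ * M₂ * N₁ * N₂) ^ (-(1 : ℝ) / 2) := by positivity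
  rw [Bsum, norm_mul, Complex.norm_real, Real.norm_of_nonneg h0]
  refine mul_le_mul_of_nonneg_left ?_ h0
  refine (norm_sum_le _ _).trans ?_
  rw [← nsmul_eq_mul]
  refine Finset.sum_le_card_nsmul _ _ _ fun q₁ hq₁ => ?_
  split_ifs with hco
  · refine le_trans ?_ (h q₁ hq₁ hco)
    rw [norm_mul]
    refine mul_le_mul_of_nonneg_right ?_ (norm_nonneg _)
    rw [norm_mul, norm_pow, Complex.norm_intCast, Complex.norm_natCast]
    have h1 : |((ArithmeticFunction.moebius q₁ : ℤ) : ℝ)| ≤ 1 := by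
      exact_mod_cast ArithmeticFunction.abs_moebius_le_one
    calc _ ≤ (1 : ℝ) ^ 2 * ((q / q₁ : ℕ) : ℝ) := by
          gcongr
          exact_mod_cast Nat.totient_le _
      _ = _ := by ring
  · simpa using hX

theorem norm_mul_le_of_mem_Icc {M₁ M₂ Q ε : ℝ} (hM₁ : 1 ≤ M₁) (hM₂ : 1 ≤ M₂) (hQ : 0 < Q)
    (hε : 0 < ε) (hε1 : ε ≤ 1) (hM : M₁ * M₂ ≤ Q ^ (1 - ε)) {α β : ℕ → ℂ}
    (hα : ∀ m₁ : ℕ, M₁ ≤ (m₁ : ℝ) → (m₁ : ℝ) ≤ 2 * M₁ → ‖α m₁‖ ≤ (m₁ : ℝ) ^ ε)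
    (hβ : ∀ m₂ : ℕ, M₂ ≤ (m₂ : ℝ) → (m₂ : ℝ) ≤ 2 * M₂ → ‖β m₂‖ ≤ (m₂ : ℝ) ^ ε)
    {m₁ m₂ : ℕ} (h₁ : m₁ ∈ Finset.Icc ⌈M₁⌉₊ ⌊2 * M₁⌋₊) (h₂ : m₂ ∈ Finset.Icc ⌈M₂⌉₊ ⌊2 * M₂⌋₊) :
    ‖α m₁ * β m₂‖ ≤ 4 * Q ^ ((1 - ε) * ε) := by
  rw [Finset.mem_Icc, Nat.ceil_le, Nat.le_floor_iff (by linarith)] at h₁ h₂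
  rw [norm_mul]
  calc _ ≤ (m₁ : ℝ) ^ ε * (m₂ : ℝ) ^ ε :=
        mul_le_mul (hα _ h₁.1 h₁.2) (hβ _ h₂.1 h₂.2) (norm_nonneg _) (by positivity)
    _ ≤ (2 * M₁) ^ ε * (2 * M₂) ^ ε := by gcongr <;> tauto
    _ = (4 * (M₁ * M₂)) ^ ε := by
        rw [← Real.mul_rpow (by positivity) (by positivity)]; ring_nf
    _ ≤ (4 * Q ^ (1 - ε)) ^ ε := by gcongr
    _ = 4 ^ ε * Q ^ ((1 - ε) * ε) := by
        rw [Real.mul_rpow (by norm_num) (by positivity), ← Real.rpow_mul hQ.le]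
    _ ≤ _ := by
        gcongr
        exact (Real.rpow_le_rpow_of_exponent_le (by norm_num) hε1).trans (Real.rpow_one 4).le

theorem exists_abs_le_and_lipschitz {W : ℝ → ℝ} (hW : ContDiff ℝ (⊤ : ℕ∞) W)
    (hWs : Function.support W ⊆ Icc (1 / 2 : ℝ) 2) :
    ∃ B L : ℝ, (∀ x, |W x| ≤ B) ∧ ∀ x y, |W x - W y| ≤ L * |x - y| := by
  have hc : HasCompactSupport W := HasCompactSupport.of_support_subset_isCompact isCompact_Icc hWs
  obtain ⟨B, hB⟩ := hc.exists_bound_of_continuous hW.continuous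
  obtain ⟨L, hL⟩ := hW.lipschitzWith_of_hasCompactSupport hc (by simp)
  exact ⟨B, L, hB, fun x y => by simpa [Real.dist_eq] using hL.dist_le_mul x y⟩

end

/-- Michel–VanderKam's bound: for `M₁M₂ ≤ q^{1-ε}`,
`|B(M₁,M₂,N₁,N₂)| ≤ C (q^ε (M₁M₂N₁/(qN₂))^{1/2} + q^{-ε})`. -/
theorem bilinear_sum_bound_MV (ε : ℝ) (hε : 0 < ε) (hε' : ε < 1/10) (W₁ W₂ : ℝ → ℝ)
    (hW₁ : ContDiff ℝ (⊤ : ℕ∞) W₁) (hW₁s : Function.support W₁ ⊆ Set.Icc (1/2 : ℝ) 2)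
    (hW₂ : ContDiff ℝ (⊤ : ℕ∞) W₂) (hW₂s : Function.support W₂ ⊆ Set.Icc (1/2 : ℝ) 2) :
    ∃ C : ℝ, 0 < C ∧ ∀ q : ℕ, 2 ≤ q → ∀ M₁ M₂ N₁ N₂ : ℝ,
      1 ≤ M₁ → 1 ≤ M₂ → 1 ≤ N₁ → 1 ≤ N₂ →
      M₁ * M₂ ≤ (q : ℝ) ^ (1 - ε) → N₁ * N₂ ≤ (q : ℝ) ^ (1 + ε) →
      ∀ α β : ℕ → ℂ,
      (∀ m₁ : ℕ, M₁ ≤ (m₁ : ℝ) → (m₁ : ℝ) ≤ 2 * M₁ → ‖α m₁‖ ≤ (m₁ : ℝ) ^ ε) →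
      (∀ m₂ : ℕ, M₂ ≤ (m₂ : ℝ) → (m₂ : ℝ) ≤ 2 * M₂ → ‖β m₂‖ ≤ (m₂ : ℝ) ^ ε) →
      ‖Bsum q M₁ M₂ N₁ N₂ W₁ W₂ α β‖ ≤
        C * ((q : ℝ) ^ ε * (M₁ * M₂ * N₁ / ((q : ℝ) * N₂)) ^ ((1 : ℝ) / 2) +
          (q : ℝ) ^ (-ε)) := by
  obtain ⟨B₁, _, hB₁, -⟩ := exists_abs_le_and_lipschitz hW₁ hW₁s
  obtain ⟨B₂, L, hB₂, hL⟩ := exists_abs_le_and_lipschitz hW₂ hW₂s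
  set A : ℝ := (gammaWeight.prod gammaWeight).real Set.univ / Real.Gamma (1 / 4) ^ 2 with hAdef
  set η : ℝ := ε ^ 2 / 17 with hη
  have hη0 : 0 < η := by positivity
  have hη1 : η ≤ 1 := by rw [hη]; nlinarith
  obtain ⟨c, hc1, hc⟩ := exists_card_divisors_le hη0
  have hA0 : 0 ≤ A := (normalizedTail_nonneg 0).trans (normalizedTail_le 0)
  have hB₁0 : 0 ≤ B₁ := (abs_nonneg _).trans (hB₁ 0)
  have hB₂0 : 0 ≤ B₂ := (abs_nonneg _).trans (hB₂ 0)
  have hL0 : 0 ≤ L := by simpa using (abs_nonneg _).trans (hL 1 0)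
  set K : ℝ := 18000 * c ^ 3 * (1 + 1 / η) with hK
  have hK0 : 0 ≤ K := by positivity
  set K' : ℝ := 32 * (B₁ * (2 * A * (B₂ + L))) * c ^ 2 * (1 + K) with hK'
  have hK'0 : 0 ≤ K' := by positivity
  refine ⟨K' + 1, by positivity, fun q hq M₁ M₂ N₁ N₂ hM₁ hM₂ hN₁ hN₂ hM hN α β hα hβ => ?_⟩
  have hQ : (1 : ℝ) ≤ q := by exact_mod_cast (by omega : 1 ≤ q)
  have hQ0 : (0 : ℝ) < q := by linarith
  set P : ℝ := M₁ * M₂ * N₁ with hP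
  have hP1 : 1 ≤ P := one_le_mul_of_one_le_of_one_le (one_le_mul_of_one_le_of_one_le hM₁ hM₂) hN₁
  have hPN : P * N₂ ≤ (q : ℝ) ^ 2 := by
    calc P * N₂ = M₁ * M₂ * (N₁ * N₂) := by rw [hP]; ring
      _ ≤ (q : ℝ) ^ (1 - ε) * (q : ℝ) ^ (1 + ε) := by gcongr
      _ = (q : ℝ) ^ 2 := by
        rw [← Real.rpow_add hQ0, ← Real.rpow_natCast]; congr 1; push_cast; ring
  have hPQ : P ≤ (q : ℝ) ^ 2 := (le_mul_of_one_le_right (by positivity) hN₂).trans hPN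
  set H : ℕ := ⌈(q : ℝ) * (8 * P)⌉₊ with hH
  have hHle : (H : ℝ) ≤ 9 * (q : ℝ) ^ 3 := by
    have h1 := (Nat.ceil_lt_add_one (show 0 ≤ (q : ℝ) * (8 * P) by positivity)).le
    have h2 : (1 : ℝ) ≤ (q : ℝ) ^ 3 := one_le_pow₀ hQ
    calc (H : ℝ) ≤ q * (8 * P) + 1 := h1
      _ ≤ q * (8 * (q : ℝ) ^ 2) + (q : ℝ) ^ 3 := by gcongr
      _ = _ := by ring
  set t : ℝ := c * (10 * (q : ℝ) ^ 4) ^ η with ht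
  have hτ : (q.divisors.card : ℝ) ≤ c * (q : ℝ) ^ η := hc q (by omega)
  have htτ : ∀ m : ℕ, m ≠ 0 → m ≤ q + H * q → (m.divisors.card : ℝ) ≤ t := fun m hm0 hm => by
    have h1 : (m : ℝ) ≤ q + H * q := by exact_mod_cast hm
    have h2 : (m : ℝ) ≤ 10 * (q : ℝ) ^ 4 := by
      calc (m : ℝ) ≤ q + H * q := h1
        _ ≤ (q : ℝ) ^ 4 + 9 * (q : ℝ) ^ 3 * q := by
          gcongr
          exact le_self_pow₀ hQ (by norm_num)
        _ = _ := by ring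
    exact (hc m hm0).trans (by rw [ht]; gcongr)
  have hlog := two_mul_cube_mul_one_add_log_le hQ hη0 hη1 (by linarith) ht (Nat.cast_nonneg H) hHle
  rw [← hK] at hlog
  have ht0 : 0 ≤ t := by positivity
  have hlog0 : 0 ≤ 2 * t ^ 3 * (1 + Real.log H) := by
    have := Real.log_natCast_nonneg H
    positivity
  have hbound := norm_Bsum_le (q := q) (W₁ := W₁) (W₂ := W₂) (α := α) (β := β) hM₁ hM₂ hN₁ hN₂
    (X := q.divisors.card * (4 * (q : ℝ) ^ ((1 - ε) * ε) * B₁ * (2 * A * (B₂ + L)) * (8 * P)) *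
      (N₂ + q * (2 * t ^ 3 * (1 + Real.log H)))) (by positivity) (fun q₁ hq₁ hco => by
        have hdvd := Nat.dvd_of_mem_divisors hq₁
        have : NeZero (q / q₁) :=
          ⟨(Nat.div_pos (Nat.divisor_le hq₁) (Nat.pos_of_mem_divisors hq₁)).ne'⟩
        exact totient_mul_norm_sum_le normalizedTail_le hB₁ hB₂ hL hW₁s hW₂s hM₁ hM₂ hN₁ hN₂
          (Nat.mul_div_cancel' hdvd) (Nat.pos_of_mem_divisors hq₁) hco (Nat.le_ceil _) htτ
          fun m₁ h₁ m₂ h₂ =>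
            norm_mul_le_of_mem_Icc hM₁ hM₂ hQ0 hε (by linarith) hM hα hβ h₁ h₂)
  have hsum : N₂ + q * (2 * t ^ 3 * (1 + Real.log H)) ≤
      (1 + K) * (q : ℝ) ^ (15 * η) * (N₂ + q) := by
    have h1 : (1 : ℝ) ≤ (q : ℝ) ^ (15 * η) := Real.one_le_rpow hQ (by positivity)
    calc _ ≤ (q : ℝ) ^ (15 * η) * N₂ + q * (K * (q : ℝ) ^ (15 * η)) :=
          add_le_add (le_mul_of_one_le_left (by linarith) h1) (by gcongr)
      _ ≤ (q : ℝ) ^ (15 * η) * N₂ + q * (K * (q : ℝ) ^ (15 * η)) +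
          (K * (q : ℝ) ^ (15 * η) * N₂ + (q : ℝ) ^ (15 * η) * q) :=
          le_add_of_nonneg_right (by positivity)
      _ = _ := by ring
  have hexp : (q : ℝ) ^ η * (q : ℝ) ^ η * (q : ℝ) ^ ((1 - ε) * ε) * (q : ℝ) ^ (15 * η) =
      (q : ℝ) ^ ε := by
    rw [← Real.rpow_add hQ0, ← Real.rpow_add hQ0, ← Real.rpow_add hQ0, hη]
    congr 1
    ring
  have hfinal := rpow_mul_normalization_le hQ (by linarith) (by linarith) hPN
    (show ε ≤ 1 / 4 by linarith)
  calc _ ≤ _ := hbound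
    _ ≤ (q : ℝ) ^ (-(3 : ℝ) / 2) * (P * N₂) ^ (-(1 : ℝ) / 2) *
        ((c * (q : ℝ) ^ η) * ((c * (q : ℝ) ^ η) *
          (4 * (q : ℝ) ^ ((1 - ε) * ε) * B₁ * (2 * A * (B₂ + L)) * (8 * P)) *
            ((1 + K) * (q : ℝ) ^ (15 * η) * (N₂ + q)))) := by gcongr
    _ = K' * ((q : ℝ) ^ ε * ((q : ℝ) ^ (-(3 : ℝ) / 2) * (P * N₂) ^ (-(1 : ℝ) / 2) *
        (P * (N₂ + q)))) := by
        rw [← hexp, hK']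
        ring
    _ ≤ K' * ((q : ℝ) ^ ε * (P / (q * N₂)) ^ ((1 : ℝ) / 2) + (q : ℝ) ^ (-ε)) := by gcongr
    _ ≤ _ := by
        gcongr
        linarith
end
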